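/- arXiv:2308.14069 — 2 statements merged into one kernel-verified Lean document; each statement's English description precedes it below -/
import Mathlib

section
/- There is an absolute constant c > 0 with the following property. Let p be a prime, r and h positive integers, α₁,…,α_r, β ∈ F_p, and let G = {α₁x₁ + … + α_r x_r + β : x_j ∈ {1,…,h}} ⊆ F_p. Suppose that the set {α₁x₁ + … + α_r x_r + β : x_j ∈ ℤ, |x_j| ≤ h²} has cardinality (2h²+1)^r (i.e., the enlarged generalized arithmetic progression is proper), and suppose G ⊆ R. Then |G| ≤ c · p^{1/4} · (2·log p)^{3r/2 + 1}. -/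
open Finset

/-- The set of nonzero quadratic residues in `F_p`. -/
def quadRes (p : ℕ) [Fact p.Prime] : Finset (ZMod p) :=
  Finset.univ.filter fun x => ∃ y : ZMod p, y ≠ 0 ∧ y ^ 2 = x

open Polynomial in
/-- `stepOp f e l g` is the polynomial with `f ^ l * (f ^ e * g)⁽ˡ⁾ = f ^ e * stepOp f e l g`. -/
noncomputable def stepOp {F : Type*} [Field F] (f : F[X]) (e : F) : ℕ → F[X] →ₗ[F] F[X]
  | 0 => LinearMap.id
  | l + 1 => LinearMap.mulLeft F (C (e - l) * derivative f) ∘ₗ stepOp f e l +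
      LinearMap.mulLeft F f ∘ₗ derivative ∘ₗ stepOp f e l

section Stepanov

open Polynomial

variable {F : Type*} [Field F]

lemma stepOp_succ (f : F[X]) (e : F) (l : ℕ) (g : F[X]) :
    stepOp f e (l + 1) g =
      C (e - l) * derivative f * stepOp f e l g + f * derivative (stepOp f e l g) := rfl

lemma mul_derivative_pow (f : F[X]) (e : ℕ) :
    f * derivative (f ^ e) = C (e : F) * f ^ e * derivative f := by
  cases e with
  | zero => simp
  | succ n => rw [derivative_pow_succ]; push_cast; ring

lemma pow_mul_iterate_derivative (f g : F[X]) (e l : ℕ) :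
    f ^ l * derivative^[l] (f ^ e * g) = f ^ e * stepOp f (e : F) l g := by
  induction l with
  | zero => simp [stepOp]
  | succ l ih =>
    have h := congrArg (fun u => f * derivative u) ih
    simp only [derivative_mul, mul_add] at h
    rw [← mul_assoc f (derivative _), mul_derivative_pow,
      ← mul_assoc f (derivative _) (stepOp _ _ _ _), mul_derivative_pow] at h
    rw [Function.iterate_succ_apply', stepOp_succ, map_sub]
    have h2 : C (l : F) * f ^ l * derivative f * derivative^[l] (f ^ e * g) =
        C (l : F) * derivative f * (f ^ e * stepOp f (e : F) l g) := by rw [← ih]; ring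
    linear_combination h - h2

lemma natDegree_stepOp_le (f : F[X]) (e : F) (l : ℕ) (g : F[X]) :
    (stepOp f e l g).natDegree ≤ g.natDegree + l * f.natDegree := by
  induction l with
  | zero => simp [stepOp]
  | succ l ih =>
    rw [stepOp_succ]
    have h1 := natDegree_derivative_le f
    have h2 := natDegree_derivative_le (stepOp f e l g)
    refine (natDegree_add_le _ _).trans (max_le ?_ ?_)
    · refine natDegree_mul_le.trans ?_
      have := natDegree_C_mul_le (e - l) (derivative f)
      rw [add_mul]; omega
    · refine natDegree_mul_le.trans ?_
      rw [add_mul]; omega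

lemma iterate_derivative_X_pow_mul (p : ℕ) [CharP F p] (j l : ℕ) (g : F[X]) :
    derivative^[l] (X ^ (j * p) * g) = X ^ (j * p) * derivative^[l] g := by
  induction l with
  | zero => rfl
  | succ l ih =>
    rw [Function.iterate_succ_apply', ih, derivative_mul, Function.iterate_succ_apply',
      derivative_X_pow]
    simp

/-- If `r² f` is a nonzero constant times `s²` and `f` has a simple root, then `r = s = 0`. -/
lemma eq_zero_of_sq_mul_eq {f r s : F[X]} {b c : F} (hb : f.rootMultiplicity b = 1) (hc : c ≠ 0)
    (h : r ^ 2 * f = C c * s ^ 2) : r = 0 ∧ s = 0 := by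
  have hf : f ≠ 0 := by rintro rfl; simp at hb
  by_cases hr : r = 0
  · subst hr
    simpa [hc] using h.symm
  · have hs : s ≠ 0 := by
      rintro rfl
      simp [hf, hr] at h
    exfalso
    have h1 := congrArg (rootMultiplicity b) h
    rw [rootMultiplicity_mul (by simp [hf, hr]), rootMultiplicity_mul (by simp [hs, hc]), sq, sq,
      rootMultiplicity_mul (by simp [hr]), rootMultiplicity_mul (by simp [hs]), rootMultiplicity_C,
      hb] at h1
    omega

end Stepanov

section StepanovZMod

open Polynomial

variable {p : ℕ} [Fact p.Prime]

lemma X_pow_dvd_pow_sub_C (f : (ZMod p)[X]) : X ^ p ∣ f ^ p - C (f.eval 0) := by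
  have h1 : (X : (ZMod p)[X]) ∣ f - C (f.eval 0) := by
    rw [X_dvd_iff]; simp [coeff_zero_eq_eval_zero]
  have h2 := pow_dvd_pow_of_dvd h1 p
  rwa [sub_pow_char, ← C_pow, ZMod.pow_card] at h2

lemma eq_zero_of_X_pow_dvd {f r s : (ZMod p)[X]} {b : ZMod p} {K q : ℕ}
    (hq : 2 * q + 1 = p) (h0 : f.eval 0 ≠ 0) (hb : f.rootMultiplicity b = 1)
    (hK : 2 * K + f.natDegree ≤ p + 1) (hr : r.natDegree < K) (hs : s.natDegree < K)
    (h : X ^ p ∣ r + s * f ^ q) : r = 0 ∧ s = 0 := by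
  refine eq_zero_of_sq_mul_eq hb h0 ?_
  rw [← sub_eq_zero]
  by_contra hne
  have hd : X ^ p ∣ r ^ 2 * f - C (f.eval 0) * s ^ 2 := by
    have e : r ^ 2 * f - C (f.eval 0) * s ^ 2 =
        (r + s * f ^ q) * ((r - s * f ^ q) * f) + (f ^ p - C (f.eval 0)) * s ^ 2 := by
      have hp : f ^ p = f ^ (2 * q + 1) := by rw [hq]
      rw [hp]
      ring
    rw [e]
    exact dvd_add (h.mul_right _) ((X_pow_dvd_pow_sub_C f).mul_right _)
  have h1 := natDegree_le_of_dvd hd hne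
  have h2 : (r ^ 2 * f).natDegree ≤ 2 * r.natDegree + f.natDegree :=
    natDegree_mul_le.trans (by gcongr; exact natDegree_pow_le)
  have h3 : (C (f.eval 0) * s ^ 2).natDegree ≤ 2 * s.natDegree :=
    (natDegree_C_mul_le _ _).trans natDegree_pow_le
  have h4 := natDegree_sub_le (r ^ 2 * f) (C (f.eval 0) * s ^ 2)
  rw [natDegree_X_pow] at h1
  omega

lemma eq_zero_of_sum_X_pow_mul {f : (ZMod p)[X]} {b : ZMod p} {K q : ℕ}
    (hq : 2 * q + 1 = p) (h0 : f.eval 0 ≠ 0) (hb : f.rootMultiplicity b = 1)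
    (hK : 2 * K + f.natDegree ≤ p + 1) (J : ℕ) (r s : ℕ → (ZMod p)[X])
    (hr : ∀ j, (r j).natDegree < K) (hs : ∀ j, (s j).natDegree < K)
    (h : ∑ j ∈ range J, X ^ (j * p) * (r j + s j * f ^ q) = 0) :
    ∀ j < J, r j = 0 ∧ s j = 0 := by
  induction J generalizing r s with
  | zero => simp
  | succ J ih =>
    rw [sum_range_succ'] at h
    have e : ∑ j ∈ range J, (X : (ZMod p)[X]) ^ ((j + 1) * p) * (r (j + 1) + s (j + 1) * f ^ q) =
        X ^ p * ∑ j ∈ range J, X ^ (j * p) * (r (j + 1) + s (j + 1) * f ^ q) := by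
      rw [mul_sum]
      refine sum_congr rfl fun j _ => ?_
      ring
    rw [e] at h
    simp only [zero_mul, pow_zero, one_mul] at h
    have h00 : r 0 = 0 ∧ s 0 = 0 := by
      refine eq_zero_of_X_pow_dvd hq h0 hb hK (hr 0) (hs 0) ?_
      rw [eq_neg_of_add_eq_zero_right h]
      exact (dvd_mul_right _ _).neg_right
    rw [h00.1, h00.2] at h
    simp only [zero_mul, add_zero] at h
    have h5 := (mul_eq_zero.mp h).resolve_left (pow_ne_zero _ X_ne_zero)
    intro j hj
    cases j with
    | zero => exact h00
    | succ j =>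
      exact ih (fun j => r (j + 1)) (fun j => s (j + 1)) (fun j => hr _) (fun j => hs _) h5 j
        (by omega)

lemma exists_stepanov_coeffs {F : Type*} [Field F] (f : F[X]) (a e : F) {J K M : ℕ} (hK : 0 < K)
    (hJ : M * (K + J + M * f.natDegree) < 2 * J * K) :
    ∃ r s : ℕ → F[X], (∀ j, (r j).natDegree < K) ∧ (∀ j, (s j).natDegree < K) ∧
      (∃ j < J, r j ≠ 0 ∨ s j ≠ 0) ∧
      ∀ l < M, ∑ j ∈ range J, X ^ j * (stepOp f 0 l (r j) + C a * stepOp f e l (s j)) = 0 := by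
  set D := K + J + M * f.natDegree with hD
  let V := (Fin J → degreeLT F K) × (Fin J → degreeLT F K)
  let E : ℕ → V →ₗ[F] F[X] := fun l =>
    ∑ j : Fin J, LinearMap.mulLeft F (X ^ (j : ℕ)) ∘ₗ
      (stepOp f 0 l ∘ₗ (degreeLT F K).subtype ∘ₗ LinearMap.proj j ∘ₗ LinearMap.fst F _ _ +
        LinearMap.mulLeft F (C a) ∘ₗ stepOp f e l ∘ₗ (degreeLT F K).subtype ∘ₗ
          LinearMap.proj j ∘ₗ LinearMap.snd F _ _)
  let T : V →ₗ[F] (Fin M → Fin D → F) :=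
    LinearMap.pi fun l => LinearMap.pi fun i => lcoeff F i ∘ₗ E l
  have hfin : Module.finrank F (degreeLT F K) = K := by
    rw [(degreeLTEquiv F K).finrank_eq]; simp
  have : Module.Finite F (degreeLT F K) := Module.Finite.equiv (degreeLTEquiv F K).symm
  have hker : LinearMap.ker T ≠ ⊥ := by
    apply LinearMap.ker_ne_bot_of_finrank_lt
    rw [Module.finrank_prod]
    simp only [Module.finrank_pi_fintype, hfin, Module.finrank_self, Fintype.card_fin, sum_const,
      card_univ, smul_eq_mul, mul_one]
    linarith
  obtain ⟨⟨r, s⟩, hv, hne⟩ := (Submodule.ne_bot_iff _).mp hker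
  have hdeg : ∀ x : degreeLT F K, (x : F[X]).natDegree < K := fun x => by
    have := mem_degreeLT.mp x.2
    by_cases h : (x : F[X]) = 0
    · simpa [h] using hK
    · exact (natDegree_lt_iff_degree_lt h).mpr this
  refine ⟨fun j => if h : j < J then (r ⟨j, h⟩ : F[X]) else 0,
    fun j => if h : j < J then (s ⟨j, h⟩ : F[X]) else 0, fun j => ?_, fun j => ?_, ?_, ?_⟩
  · dsimp only
    split_ifs
    exacts [hdeg _, by simpa using hK]
  · dsimp only
    split_ifs
    exacts [hdeg _, by simpa using hK]
  · by_contra! hc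
    apply hne
    ext j : 2
    · have := (hc j j.2).1
      simp only [j.2, dite_true] at this
      exact Subtype.ext this
    · have := (hc j j.2).2
      simp only [j.2, dite_true] at this
      exact Subtype.ext this
  · intro l hl
    have hE : E l (r, s) = ∑ j : Fin J, X ^ (j : ℕ) *
        (stepOp f 0 l (r j) + C a * stepOp f e l (s j)) := by
      simp only [E, LinearMap.sum_apply]
      rfl
    rw [Finset.sum_range]
    simp only [Fin.is_lt, dite_true, Fin.eta]
    rw [← hE]
    ext i
    rw [coeff_zero]
    by_cases hi : i < D
    · have := congrFun (congrFun (LinearMap.mem_ker.mp hv) ⟨l, hl⟩) ⟨i, hi⟩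
      simpa [T] using this
    · apply coeff_eq_zero_of_natDegree_lt
      rw [hE]
      have hD0 : 0 < D := by omega
      refine lt_of_le_of_lt (natDegree_sum_le_of_forall_le (n := D - 1) _ _ fun j _ => ?_)
        (by omega : D - 1 < i)
      have h1 := natDegree_stepOp_le f 0 l (r j)
      have h2 := natDegree_stepOp_le f e l (s j)
      have h3 := natDegree_C_mul_le a (stepOp f e l (s j))
      have h4 := natDegree_add_le (stepOp f 0 l (r j)) (C a * stepOp f e l (s j))
      have h5 := natDegree_mul_le (p := (X : F[X]) ^ (j : ℕ))
        (q := stepOp f 0 l (r j) + C a * stepOp f e l (s j))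
      rw [natDegree_X_pow] at h5
      have h6 : l * f.natDegree ≤ M * f.natDegree := by gcongr
      have := hdeg (r j)
      have := hdeg (s j)
      omega

/-- Stepanov's bound for the number of points where `f ^ ((p - 1) / 2)` takes the value `a`. -/
lemma stepanov_card_le {f : (ZMod p)[X]} {a b : ZMod p} {q J K M : ℕ} (hq : 2 * q + 1 = p)
    (h0 : f.eval 0 ≠ 0) (hb : f.rootMultiplicity b = 1) (ha : a ≠ 0) (hq0 : q ≠ 0) (hK0 : 0 < K)
    (hJ : M * (K + J + M * f.natDegree) < 2 * J * K) (hK : 2 * K + f.natDegree ≤ p + 1)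
    (hM : M < p) :
    M * #{x : ZMod p | f.eval x ^ q = a} ≤ J * p + q * f.natDegree := by
  obtain ⟨r, s, hr, hs, ⟨j₀, hj₀, hne⟩, hE⟩ :=
    exists_stepanov_coeffs f a (q : ZMod p) hK0 hJ
  set Φ : (ZMod p)[X] := ∑ j ∈ range J, X ^ (j * p) * (r j + s j * f ^ q) with hΦ
  have hΦ0 : Φ ≠ 0 := fun h => by
    have := eq_zero_of_sum_X_pow_mul hq h0 hb hK J r s hr hs h j₀ hj₀
    tauto
  have hdeg : Φ.natDegree ≤ J * p + q * f.natDegree := by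
    refine natDegree_sum_le_of_forall_le _ _ fun j hj => ?_
    have hj : j < J := Finset.mem_range.mp hj
    have hj' : (j + 1) * p ≤ J * p := by gcongr; omega
    have h1 : (s j * f ^ q).natDegree ≤ (s j).natDegree + q * f.natDegree :=
      natDegree_mul_le.trans (by gcongr; exact natDegree_pow_le)
    have h2 := natDegree_add_le (r j) (s j * f ^ q)
    have h3 := natDegree_mul_le (p := (X : (ZMod p)[X]) ^ (j * p)) (q := r j + s j * f ^ q)
    rw [natDegree_X_pow] at h3
    have := hr j
    have := hs j
    rw [add_mul] at hj'
    have : K ≤ p + 1 := by omega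
    omega
  have hder : ∀ x : ZMod p, f.eval x ^ q = a → ∀ l < M, (derivative^[l] Φ).IsRoot x := by
    intro x hx l hl
    have hfx : f.eval x ≠ 0 := by
      intro h
      rw [h, zero_pow hq0] at hx
      exact ha hx.symm
    have key : f ^ l * derivative^[l] Φ =
        ∑ j ∈ range J, X ^ (j * p) * (stepOp f 0 l (r j) + f ^ q * stepOp f q l (s j)) := by
      rw [hΦ, iterate_derivative_sum, mul_sum]
      refine sum_congr rfl fun j _ => ?_
      rw [iterate_derivative_X_pow_mul p, iterate_map_add, mul_comm (s j),
        ← pow_mul_iterate_derivative]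
      have := pow_mul_iterate_derivative f (r j) 0 l
      simp only [pow_zero, one_mul, Nat.cast_zero] at this
      rw [← this]
      ring
    have h1 := congrArg (eval x) key
    have h2 := congrArg (eval x) (hE l hl)
    simp only [eval_mul, eval_finsetSum, eval_pow, eval_X, eval_add, eval_C, eval_zero, hx,
      pow_mul', ZMod.pow_card] at h1 h2
    rw [h2] at h1
    exact (mul_eq_zero.mp h1).resolve_left (pow_ne_zero _ hfx)
  have hmult : ∀ x : ZMod p, f.eval x ^ q = a → M ≤ Φ.rootMultiplicity x := by
    intro x hx
    rcases Nat.eq_zero_or_pos M with rfl | hM0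
    · simp
    have := lt_rootMultiplicity_of_isRoot_iterate_derivative_of_mem_nonZeroDivisors' (n := M - 1)
      hΦ0 (fun l hl => hder x hx l (by omega)) (fun l hl hl0 => by
        rw [mem_nonZeroDivisors_iff_ne_zero, Ne, ZMod.natCast_eq_zero_iff]
        exact Nat.not_dvd_of_pos_of_lt (by omega) (by omega))
    omega
  calc M * #{x : ZMod p | f.eval x ^ q = a}
      = ∑ x : ZMod p with f.eval x ^ q = a, M := by simp [mul_comm]
    _ ≤ ∑ x : ZMod p with f.eval x ^ q = a, Φ.rootMultiplicity x :=
        sum_le_sum fun x hx => hmult x (by simpa using hx)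
    _ = ∑ x : ZMod p with f.eval x ^ q = a, Φ.roots.count x := by simp
    _ ≤ ∑ x : ZMod p, Φ.roots.count x := sum_le_univ_sum_of_nonneg fun _ => Nat.zero_le _
    _ = Multiset.card Φ.roots := Multiset.sum_count_eq_card fun x _ => mem_univ x
    _ ≤ Φ.natDegree := card_roots' _
    _ ≤ _ := hdeg

lemma stepanov_two_mul_card_le {f : (ZMod p)[X]} {a b : ZMod p} {q : ℕ} (hq : 2 * q + 1 = p)
    (h0 : f.eval 0 ≠ 0) (hb : f.rootMultiplicity b = 1) (ha : a ≠ 0) (hm : 0 < f.natDegree)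
    (hp : 4 * f.natDegree + 6 ≤ Nat.sqrt p) :
    2 * (#{x : ZMod p | f.eval x ^ q = a} : ℝ) ≤ p + 22 * f.natDegree * √p := by
  set m := f.natDegree with hmdef
  set M := Nat.sqrt p with hMdef
  set N := #{x : ZMod p | f.eval x ^ q = a} with hN
  have hM2 : M * M ≤ p := Nat.sqrt_le p
  have hM3 : p < (M + 1) * (M + 1) := Nat.lt_succ_sqrt p
  have hmM : 4 * m ≤ p := by nlinarith
  have hMp : M < p := by nlinarith
  have hJM : M / 2 + 2 * m + 3 ≤ M := by omega
  have hK1 : p ≤ 2 * ((p + 1 - m) / 2) + m := by omega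
  have hK2 : 2 * ((p + 1 - m) / 2) + m ≤ p + 1 := by omega
  have hJ2 : M + 4 * m + 5 ≤ 2 * (M / 2 + 2 * m + 3) := by omega
  have hJ3 : 2 * (M / 2 + 2 * m + 3) ≤ M + 4 * m + 6 := by omega
  have hK0 : 0 < (p + 1 - m) / 2 := by omega
  generalize hK : (p + 1 - m) / 2 = K at *
  generalize hJ : M / 2 + 2 * m + 3 = J at *
  have h1 : M * (K + J + M * m) < 2 * J * K := by
    have e1 : (M + 4 * m + 5) * K ≤ 2 * J * K := by gcongr
    have e2 : M * J ≤ M * M := by gcongr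
    have e3 : M * M * m ≤ p * m := by gcongr
    have e4 : 3 * p ≤ 8 * K := by omega
    have e5 : (4 * m + 5) * (3 * p) ≤ (4 * m + 5) * (8 * K) := by gcongr
    nlinarith
  have h2 := stepanov_card_le hq h0 hb ha (by omega) hK0 h1 hK2 hMp
  have h3 : 2 * M * N ≤ M * p + (5 * m + 6) * p := by
    have : 2 * q * m ≤ p * m := by gcongr; omega
    have : 2 * J * p ≤ (M + 4 * m + 6) * p := by gcongr
    nlinarith
  have h3' : 2 * (M : ℝ) * N ≤ M * p + (5 * m + 6) * p := by exact_mod_cast h3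
  have hs0 : (0 : ℝ) ≤ √p := Real.sqrt_nonneg _
  have hs : √(p : ℝ) * √p = p := Real.mul_self_sqrt (by positivity)
  have hsM : √(p : ℝ) ≤ 2 * M := by
    rw [Real.sqrt_le_left (by positivity)]
    have : p ≤ (2 * M) ^ 2 := by nlinarith
    exact_mod_cast this
  have hM0 : (0 : ℝ) < M := by exact_mod_cast (by omega : 0 < M)
  have hm1 : (1 : ℝ) ≤ m := by exact_mod_cast hm
  have h4 : (p : ℝ) ≤ 2 * M * √p := by nlinarith
  have h5 : M * (2 * (N : ℝ)) ≤ M * (p + 22 * m * √p) := by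
    have : (5 * (m : ℝ) + 6) * p ≤ (11 * m) * (2 * M * √p) := by gcongr; linarith
    nlinarith
  exact le_of_mul_le_mul_left h5 hM0

lemma abs_sum_quadraticChar_le {f : (ZMod p)[X]} {b : ZMod p} (h0 : f.eval 0 ≠ 0)
    (hb : f.rootMultiplicity b = 1) (hm : 0 < f.natDegree)
    (hp : 4 * f.natDegree + 6 ≤ Nat.sqrt p) :
    |((∑ x : ZMod p, quadraticChar (ZMod p) (f.eval x) : ℤ) : ℝ)| ≤ 23 * f.natDegree * √p := by
  have hp2 : p ≠ 2 := by
    rintro rfl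
    have : Nat.sqrt 2 ≤ 2 := Nat.sqrt_le_self 2
    omega
  have hchar : ringChar (ZMod p) ≠ 2 := by rwa [ZMod.ringChar_zmod_n]
  have hodd : 2 * (p / 2) + 1 = p := by
    have := (Fact.out : p.Prime).eq_two_or_odd
    omega
  set q := p / 2 with hq
  have hne : (1 : ZMod p) ≠ -1 := (Ring.neg_one_ne_one_of_char_ne_two hchar).symm
  have hpow : ∀ y : ZMod p, ((quadraticChar (ZMod p) y : ℤ) : ZMod p) = y ^ q := fun y => by
    rw [quadraticChar_eq_pow_of_char_ne_two' hchar, ZMod.card]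
  have hval : ∀ y : ZMod p, quadraticChar (ZMod p) y =
      (if y ^ q = 1 then 1 else 0) - (if y ^ q = -1 then 1 else 0) := by
    intro y
    rw [← hpow]
    by_cases hy : y = 0
    · subst hy; simp
    · rcases quadraticChar_dichotomy hy with h | h <;> simp [h, hne, hne.symm]
  set A := #{x : ZMod p | f.eval x ^ q = 1} with hA
  set B := #{x : ZMod p | f.eval x ^ q = -1} with hB
  have hsum : ∑ x : ZMod p, quadraticChar (ZMod p) (f.eval x) = (A : ℤ) - B := by
    simp_rw [hval, sum_sub_distrib]
    simp [hA, hB]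
  have hf : f ≠ 0 := by rintro rfl; simp at hb
  have hroot : #{x : ZMod p | f.eval x = 0} ≤ f.natDegree := by
    refine le_trans (card_le_card ?_) ((Multiset.toFinset_card_le f.roots).trans (card_roots' f))
    intro x hx
    simpa [hf] using hx
  have hcov : p ≤ A + B + f.natDegree := by
    have : (univ : Finset (ZMod p)) ⊆ ({x : ZMod p | f.eval x ^ q = 1} : Finset _) ∪
        ({x : ZMod p | f.eval x ^ q = -1} : Finset _) ∪
        ({x : ZMod p | f.eval x = 0} : Finset _) := by
      intro x _
      simp only [mem_union, mem_filter, mem_univ, true_and]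
      by_cases hx : f.eval x = 0
      · exact Or.inr hx
      · left
        rw [← hpow]
        rcases quadraticChar_dichotomy hx with h | h <;> simp [h]
    have h1 := card_le_card this
    rw [card_univ, ZMod.card] at h1
    have h2 := card_union_le (({x : ZMod p | f.eval x ^ q = 1} : Finset _) ∪
        ({x : ZMod p | f.eval x ^ q = -1} : Finset _)) ({x : ZMod p | f.eval x = 0} : Finset _)
    have h3 := card_union_le ({x : ZMod p | f.eval x ^ q = 1} : Finset _)
      ({x : ZMod p | f.eval x ^ q = -1} : Finset _)
    omega
  have hA' := stepanov_two_mul_card_le (a := 1) hodd h0 hb one_ne_zero hm hp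
  have hB' := stepanov_two_mul_card_le (a := -1) hodd h0 hb (by simp) hm hp
  rw [← hA] at hA'
  rw [← hB] at hB'
  have hcov' : (p : ℝ) ≤ A + B + f.natDegree := by exact_mod_cast hcov
  have hs1 : (1 : ℝ) ≤ √p := by
    rw [Real.one_le_sqrt]
    exact_mod_cast (Fact.out : p.Prime).one_lt.le
  have hms : (f.natDegree : ℝ) ≤ f.natDegree * √p := le_mul_of_one_le_right (by positivity) hs1
  rw [hsum]
  push_cast
  rw [abs_le]
  constructor <;> linarith

lemma abs_sum_prod_quadraticChar_le {A : Finset (ZMod p)} (hA : A.Nonempty) (h0 : 0 ∉ A)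
    (hp : 4 * #A + 6 ≤ Nat.sqrt p) :
    |((∑ y : ZMod p, ∏ c ∈ A, quadraticChar (ZMod p) (y - c) : ℤ) : ℝ)| ≤ 23 * #A * √p := by
  obtain ⟨b, hb⟩ := hA
  have hdeg : (∏ c ∈ A, (X - C c)).natDegree = #A := by
    rw [natDegree_prod_of_monic _ _ fun c _ => monic_X_sub_C c]
    simp
  have h := abs_sum_quadraticChar_le (f := ∏ c ∈ A, (X - C c)) (b := b) ?_ ?_ ?_ ?_
  · simpa [eval_prod, hdeg] using h
  · rw [eval_prod, prod_ne_zero_iff]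
    rintro c hc
    have : c ≠ 0 := fun h => h0 (h ▸ hc)
    simpa using this
  · rw [← count_roots, roots_prod_X_sub_C]
    exact Multiset.count_eq_one_of_mem A.nodup hb
  · rw [hdeg]; exact card_pos.mpr ⟨b, hb⟩
  · rwa [hdeg]

/-- Few `y` have `χ (y - c) = ε` for all `c` in a set `A` of small size. -/
lemma two_pow_mul_card_quadraticChar_le {A : Finset (ZMod p)} (h0 : 0 ∉ A)
    (hp : 4 * #A + 6 ≤ Nat.sqrt p) {ε : ℤ} (hε : ε = 1 ∨ ε = -1) :
    2 ^ #A * (#{y : ZMod p | ∀ c ∈ A, quadraticChar (ZMod p) (y - c) = ε} : ℝ) ≤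
      p + 2 ^ #A * (23 * #A * √p) := by
  set Z := ({y : ZMod p | ∀ c ∈ A, quadraticChar (ZMod p) (y - c) = ε} : Finset _) with hZ
  have hεε : ε * ε = 1 := by rcases hε with rfl | rfl <;> rfl
  have hnn : ∀ y : ZMod p, 0 ≤ ∏ c ∈ A, (1 + ε * quadraticChar (ZMod p) (y - c)) := by
    intro y
    refine prod_nonneg fun c _ => ?_
    by_cases hc : y - c = 0
    · simp [hc]
    · rcases quadraticChar_dichotomy hc with h | h <;> rcases hε with rfl | rfl <;> simp [h]
  have hlow : (2 : ℤ) ^ #A * #Z ≤ ∑ y : ZMod p, ∏ c ∈ A, (1 + ε * quadraticChar (ZMod p) (y - c)) :=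
    calc (2 : ℤ) ^ #A * #Z = ∑ y ∈ Z, ∏ c ∈ A, (1 + ε * quadraticChar (ZMod p) (y - c)) := by
          rw [mul_comm, ← nsmul_eq_mul, ← sum_const]
          refine sum_congr rfl fun y hy => ?_
          rw [← prod_const]
          refine prod_congr rfl fun c hc => ?_
          rw [(mem_filter.mp hy).2 c hc, hεε]
          rfl
      _ ≤ _ := sum_le_univ_sum_of_nonneg hnn
  have hexp : ∑ y : ZMod p, ∏ c ∈ A, (1 + ε * quadraticChar (ZMod p) (y - c)) =
      p + ∑ S ∈ A.powerset.erase ∅,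
        ε ^ #S * ∑ y : ZMod p, ∏ c ∈ S, quadraticChar (ZMod p) (y - c) := by
    simp_rw [prod_one_add]
    rw [sum_comm, ← add_sum_erase _ _ (empty_mem_powerset A)]
    congr 1
    · simp [ZMod.card]
    · refine sum_congr rfl fun S _ => ?_
      rw [mul_sum]
      refine sum_congr rfl fun y _ => ?_
      rw [prod_mul_distrib, prod_const]
  have hlow' : (2 : ℝ) ^ #A * #Z ≤ ((p + ∑ S ∈ A.powerset.erase ∅,
      ε ^ #S * ∑ y : ZMod p, ∏ c ∈ S, quadraticChar (ZMod p) (y - c) : ℤ) : ℝ) := by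
    rw [← hexp]
    exact_mod_cast hlow
  refine hlow'.trans ?_
  rw [Int.cast_add, Int.cast_natCast, Int.cast_sum]
  gcongr
  have hterm : ∀ S ∈ A.powerset.erase ∅,
      ((ε ^ #S * ∑ y : ZMod p, ∏ c ∈ S, quadraticChar (ZMod p) (y - c) : ℤ) : ℝ) ≤
        23 * #A * √p := by
    intro S hS
    rw [mem_erase, mem_powerset] at hS
    have hcard : #S ≤ #A := card_le_card hS.2
    refine (le_abs_self _).trans ?_
    rw [Int.cast_mul, abs_mul]
    have hεabs : |((ε ^ #S : ℤ) : ℝ)| = 1 := by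
      push_cast
      rw [abs_pow]
      rcases hε with rfl | rfl <;> simp
    rw [hεabs, one_mul]
    refine (abs_sum_prod_quadraticChar_le (nonempty_iff_ne_empty.mpr hS.1)
      (fun h => h0 (hS.2 h)) (by omega)).trans ?_
    gcongr
  refine (sum_le_card_nsmul _ _ _ hterm).trans ?_
  rw [nsmul_eq_mul]
  gcongr
  have := (card_erase_le (s := A.powerset) (a := ∅))
  rw [card_powerset] at this
  exact_mod_cast this

end StepanovZMod

section Geometry

/-- Hadamard's inequality, for a matrix whose columns have bounded entries. -/
lemma abs_det_le_sqrt_card_pow_mul_prod {ι : Type*} [Fintype ι] [DecidableEq ι]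
    (A : Matrix ι ι ℝ) (B : ι → ℝ) (hB : ∀ i, 0 ≤ B i) (hA : ∀ i j, |A i j| ≤ B j) :
    |A.det| ≤ √(Fintype.card ι) ^ Fintype.card ι * ∏ i, B i := by
  set n := Fintype.card ι with hn
  let e := Fintype.equivFin ι
  have : Fact (Module.finrank ℝ (EuclideanSpace ℝ (Fin n)) = n) := ⟨by simp⟩
  let b := EuclideanSpace.basisFun (Fin n) ℝ
  let v : Fin n → EuclideanSpace ℝ (Fin n) :=
    fun j => WithLp.toLp 2 fun i => A (e.symm i) (e.symm j)
  have hdet : A.det = b.toBasis.det v := by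
    rw [Module.Basis.det_apply, ← Matrix.det_reindex_self e A]
    rfl
  have hle := (b.toBasis.orientation).abs_volumeForm_apply_le v
  rw [Orientation.volumeForm_robust' _ b, ← hdet] at hle
  refine hle.trans ?_
  have hnorm : ∀ j, ‖v j‖ ≤ √n * B (e.symm j) := by
    intro j
    rw [EuclideanSpace.norm_eq, ← Real.sqrt_sq (hB (e.symm j)), ← Real.sqrt_mul (by positivity)]
    apply Real.sqrt_le_sqrt
    calc ∑ i, ‖(v j) i‖ ^ 2 ≤ ∑ _i : Fin n, B (e.symm j) ^ 2 :=
          sum_le_sum fun i _ => pow_le_pow_left₀ (norm_nonneg _) (hA _ _) 2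
      _ = _ := by simp
  calc ∏ j, ‖v j‖ ≤ ∏ j, (√n * B (e.symm j)) :=
        prod_le_prod (fun j _ => norm_nonneg _) fun j _ => hnorm j
    _ = _ := by
        rw [prod_mul_distrib, prod_const, card_univ, Fintype.card_fin, Equiv.prod_comp e.symm B]

/-- Short integer vectors in a lattice of large prime covolume lie in a real hyperplane. -/
lemma exists_hyperplane_of_sum_eq_zero {ι : Type*} [Fintype ι] [DecidableEq ι] {p : ℕ}
    [Fact p.Prime] {γ : ι → ZMod p} (hγ : γ ≠ 0) (D : Set (ι → ℤ)) (B : ι → ℕ)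
    (hB : √(Fintype.card ι) ^ Fintype.card ι * ∏ i, (B i : ℝ) < p)
    (hD : ∀ d ∈ D, ∀ i, |d i| ≤ B i) (hD0 : ∀ d ∈ D, ∑ i, (d i : ZMod p) * γ i = 0) :
    ∃ c : ι → ℝ, c ≠ 0 ∧ ∀ d ∈ D, ∑ i, c i * d i = 0 := by
  let cast : (ι → ℤ) → ι → ℝ := fun d i => d i
  have hlt : Submodule.span ℝ (cast '' D) < ⊤ := by
    rw [lt_top_iff_ne_top]
    intro htop
    obtain ⟨b, hbD, hspan, hli⟩ := exists_linearIndependent ℝ (cast '' D)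
    let bas := Module.Basis.mk hli (by rw [Subtype.range_coe, hspan, htop])
    let e := (Pi.basisFun ℝ ι).indexEquiv bas
    choose d hd hdc using fun k : ι => hbD (e k).2
    let A : Matrix ι ι ℤ := Matrix.of d
    have hAr : (A.map (Int.cast : ℤ → ℝ)).det ≠ 0 := by
      have hrow : LinearIndependent ℝ (A.map (Int.cast : ℤ → ℝ)).row := by
        have hrows : (A.map (Int.cast : ℤ → ℝ)).row = Subtype.val ∘ e := funext hdc
        rw [hrows]
        exact hli.comp e e.injective
      rw [Matrix.linearIndependent_rows_iff_isUnit, Matrix.isUnit_iff_isUnit_det] at hrow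
      exact hrow.ne_zero
    have hcastdet : ((A.det : ℤ) : ℝ) = (A.map (Int.cast : ℤ → ℝ)).det :=
      (Int.castRingHom ℝ).map_det A
    have hAp : ((A.det : ℤ) : ZMod p) = 0 := by
      have h1 : ((A.det : ℤ) : ZMod p) = (A.map (Int.cast : ℤ → ZMod p)).det :=
        (Int.castRingHom (ZMod p)).map_det A
      rw [h1, ← Matrix.exists_mulVec_eq_zero_iff]
      exact ⟨γ, hγ, funext fun k => hD0 (d k) (hd k)⟩
    rw [ZMod.intCast_zmod_eq_zero_iff_dvd] at hAp
    have hbound : |((A.det : ℤ) : ℝ)| < p := by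
      rw [hcastdet]
      refine lt_of_le_of_lt (abs_det_le_sqrt_card_pow_mul_prod _ (fun i => (B i : ℝ))
        (fun i => by positivity) fun k i => ?_) hB
      have := hD (d k) (hd k) i
      simp only [Matrix.map_apply, A, Matrix.of_apply]
      exact_mod_cast this
    have hz : A.det = 0 := Int.eq_zero_of_abs_lt_dvd hAp (by exact_mod_cast hbound)
    rw [← hcastdet, hz] at hAr
    simp at hAr
  obtain ⟨φ, hφ, hker⟩ := Submodule.exists_le_ker_of_lt_top _ hlt
  have hφx : ∀ x : ι → ℝ, φ x = ∑ i, φ (Pi.single i 1) * x i := by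
    intro x
    conv_lhs => rw [pi_eq_sum_univ' x, map_sum]
    refine sum_congr rfl fun i _ => ?_
    rw [map_smul, smul_eq_mul, mul_comm]
  refine ⟨fun i => φ (Pi.single i 1), fun h => hφ ?_, fun d hd => ?_⟩
  · ext i
    simpa using congrFun h i
  · rw [← hφx fun i => (d i : ℝ)]
    exact hker (Submodule.subset_span ⟨d, hd, rfl⟩)

lemma Finset.card_le_of_forall_abs_sub_lt (s : Finset ℤ) (N : ℕ)
    (h : ∀ x ∈ s, ∀ y ∈ s, |x - y| < N) : #s ≤ N := by
  rcases s.eq_empty_or_nonempty with rfl | hs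
  · simp
  have : s ⊆ Ico (s.min' hs) (s.min' hs + N) := fun x hx => by
    have h1 := s.min'_le x hx
    have h2 := (abs_lt.mp (h x hx _ (s.min'_mem hs))).2
    rw [mem_Ico]
    omega
  simpa using card_le_card this

open scoped Pointwise in
/-- A subset of a hyperplane and a box has small sumset with a proportional smaller box. -/
lemma card_add_box_le {ι : Type*} [Fintype ι] [DecidableEq ι] (m : ℕ) (L : ι → ℕ)
    (hL : ∀ i, 0 < L i) (S : Finset (ι → ℤ)) (hS : ∀ w ∈ S, ∀ i, 1 ≤ w i ∧ w i ≤ m * L i)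
    {c : ι → ℝ} (hc : c ≠ 0) (hcS : ∀ w ∈ S, ∀ w' ∈ S, ∑ i, c i * ((w - w') i : ℤ) = 0) :
    #(S + Fintype.piFinset fun i => Ico (0 : ℤ) (L i)) ≤
      Fintype.card ι * (m + 1) ^ (Fintype.card ι - 1) * ∏ i, L i := by
  obtain ⟨k, hk⟩ := Function.ne_iff.mp hc
  obtain ⟨i₀, -, hi₀⟩ := exists_max_image univ (fun i => |c i| * L i) ⟨k, mem_univ k⟩
  have hLr : ∀ i, (0 : ℝ) < L i := fun i => by exact_mod_cast hL i
  have hpos : 0 < |c i₀| := by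
    have h1 : 0 < |c k| * L k := mul_pos (abs_pos.mpr hk) (hLr k)
    exact pos_of_mul_pos_left (h1.trans_le (hi₀ k (mem_univ k))) (hLr i₀).le
  set V := S + Fintype.piFinset fun i => Ico (0 : ℤ) (L i) with hV
  let f : (ι → ℤ) → ι → ℤ := fun z => Function.update z i₀ 0
  have hfib : ∀ z ∈ V, ∀ z' ∈ V, f z = f z' → |z i₀ - z' i₀| < (Fintype.card ι * L i₀ : ℕ) := by
    intro z hz z' hz' hzz
    obtain ⟨w, hw, θ, hθ, rfl⟩ := mem_add.mp hz
    obtain ⟨w', hw', θ', hθ', rfl⟩ := mem_add.mp hz'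
    rw [Fintype.mem_piFinset] at hθ hθ'
    have heq : ∀ i, i ≠ i₀ → (w + θ) i = (w' + θ') i := fun i hi => by
      simpa [f, hi] using congrFun hzz i
    have h1 : c i₀ * (((w + θ) i₀ - (w' + θ') i₀ : ℤ) : ℝ) = ∑ i, c i * ((θ i - θ' i : ℤ) : ℝ) := by
      have h2 : ∑ i, c i * (((w + θ) i - (w' + θ') i : ℤ) : ℝ) =
          c i₀ * (((w + θ) i₀ - (w' + θ') i₀ : ℤ) : ℝ) := by
        refine sum_eq_single i₀ (fun i _ hi => ?_) (by simp)
        rw [heq i hi]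
        simp
      rw [← h2, ← sub_eq_zero, ← hcS w hw w' hw', ← sum_sub_distrib]
      refine sum_congr rfl fun i _ => ?_
      simp only [Pi.add_apply, Pi.sub_apply]
      push_cast
      ring
    have h3 : |c i₀| * |(((w + θ) i₀ - (w' + θ') i₀ : ℤ) : ℝ)| <
        |c i₀| * (Fintype.card ι * L i₀) := by
      rw [← abs_mul, h1]
      calc |∑ i, c i * ((θ i - θ' i : ℤ) : ℝ)| ≤ ∑ i, |c i| * |((θ i - θ' i : ℤ) : ℝ)| := by
            simpa [abs_mul] using abs_sum_le_sum_abs (fun i => c i * ((θ i - θ' i : ℤ) : ℝ)) univ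
        _ < ∑ i, |c i| * L i := by
            have hlt : ∀ i, |((θ i - θ' i : ℤ) : ℝ)| < L i := fun i => by
              have a1 := mem_Ico.mp (hθ i)
              have a2 := mem_Ico.mp (hθ' i)
              have : |θ i - θ' i| < L i := by rw [abs_lt]; constructor <;> omega
              exact_mod_cast this
            exact sum_lt_sum (fun i _ => by gcongr; exact (hlt i).le)
              ⟨i₀, mem_univ _, by gcongr; exact hlt i₀⟩
        _ ≤ ∑ _i : ι, |c i₀| * L i₀ := sum_le_sum fun i _ => hi₀ i (mem_univ i)
        _ = _ := by simp; ring
    have h4 := lt_of_mul_lt_mul_left h3 hpos.le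
    exact_mod_cast h4
  have hcard : ∀ y ∈ V.image f, #{z ∈ V | f z = y} ≤ Fintype.card ι * L i₀ := by
    intro y _
    rw [← card_image_of_injOn (f := fun z : ι → ℤ => z i₀)]
    · refine Finset.card_le_of_forall_abs_sub_lt _ _ ?_
      simp only [mem_image, mem_filter]
      rintro _ ⟨z, ⟨hz, rfl⟩, rfl⟩ _ ⟨z', ⟨hz', hzz⟩, rfl⟩
      exact hfib z hz z' hz' hzz.symm
    · intro z hz z' hz' hzz
      simp only [coe_filter, Set.mem_ofPred_eq] at hz hz'
      funext i
      by_cases hi : i = i₀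
      · rw [hi]; exact hzz
      · simpa [f, hi] using congrFun (hz.2.trans hz'.2.symm) i
  have himage : #(V.image f) ≤ ∏ i ∈ univ.erase i₀, (m + 1) * L i := by
    have hsub : V.image f ⊆ Fintype.piFinset fun i =>
        if i = i₀ then {0} else Icc (1 : ℤ) (((m + 1) * L i : ℕ) : ℤ) := by
      intro y hy
      obtain ⟨z, hz, rfl⟩ := mem_image.mp hy
      obtain ⟨w, hw, θ, hθ, rfl⟩ := mem_add.mp hz
      rw [Fintype.mem_piFinset] at hθ ⊢
      intro i
      by_cases hi : i = i₀
      · simp [f, hi]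
      · have a1 := mem_Ico.mp (hθ i)
        have a2 := hS w hw i
        simp only [hi, if_false, f, Function.update_of_ne, ne_eq, not_false_eq_true, Pi.add_apply,
          mem_Icc]
        push_cast
        constructor <;> linarith
    refine (card_le_card hsub).trans (le_of_eq ?_)
    rw [Fintype.card_piFinset, ← mul_prod_erase _ _ (mem_univ i₀)]
    simp only [if_true, card_singleton, one_mul]
    refine prod_congr rfl fun i hi => ?_
    rw [if_neg (ne_of_mem_erase hi), Int.card_Icc, add_sub_cancel_right, Int.toNat_natCast]
  calc #V ≤ Fintype.card ι * L i₀ * #(V.image f) := card_le_mul_card_image V _ hcard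
    _ ≤ Fintype.card ι * L i₀ * ∏ i ∈ univ.erase i₀, (m + 1) * L i := by gcongr
    _ = _ := by
        rw [prod_mul_distrib, prod_const, card_erase_of_mem (mem_univ _), card_univ,
          ← mul_prod_erase _ L (mem_univ i₀)]
        ring

open scoped Pointwise in
/-- If `S` lies in a coset of `Γ`, then many pairs in `Θ` are congruent modulo `Γ`. -/
lemma card_mul_card_le_of_sub_mem {V : Type*} [AddCommGroup V] [DecidableEq V] (Γ : AddSubgroup V)
    [DecidablePred (· ∈ Γ)] (S Θ : Finset V) (hS : ∀ w ∈ S, ∀ w' ∈ S, w - w' ∈ Γ) {N : ℕ}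
    (hN : #(S + Θ) ≤ N * #Θ) :
    #S * #Θ ≤ N * #{x ∈ Θ ×ˢ Θ | x.1 - x.2 ∈ Γ} := by
  rcases S.eq_empty_or_nonempty with rfl | hS0
  · simp
  rcases Θ.eq_empty_or_nonempty with rfl | hΘ0
  · simp
  have hE : S.addEnergy Θ ≤ #S * #{x ∈ Θ ×ˢ Θ | x.1 - x.2 ∈ Γ} := by
    rw [addEnergy, ← card_product]
    refine card_le_card_of_injOn (fun x => (x.1.1, x.2)) ?_ ?_
    · rintro ⟨⟨a, a'⟩, b, b'⟩ hx
      simp only [coe_filter, Set.mem_ofPred_eq, mem_product] at hx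
      obtain ⟨⟨⟨ha, ha'⟩, hb, hb'⟩, h⟩ := hx
      simp only [coe_product, Set.mem_prod, mem_coe, mem_filter, mem_product]
      refine ⟨ha, ⟨hb, hb'⟩, ?_⟩
      have : b - b' = a' - a := by
        rw [sub_eq_sub_iff_add_eq_add, add_comm b, h, add_comm]
      rw [this]
      exact hS _ ha' _ ha
    · rintro ⟨⟨a, a'⟩, b, b'⟩ hx ⟨⟨c, c'⟩, d, d'⟩ hy h
      simp only [coe_filter, Set.mem_ofPred_eq] at hx hy
      simp only [Prod.mk.injEq] at h
      obtain ⟨rfl, rfl, rfl⟩ := h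
      have := hx.2.symm.trans hy.2
      simpa using this
  have h := le_card_add_mul_addEnergy S Θ
  have h2 : (#S * #Θ) * (#S * #Θ) ≤
      (#S * #Θ) * (N * #{x ∈ Θ ×ˢ Θ | x.1 - x.2 ∈ Γ}) := by
    calc (#S * #Θ) * (#S * #Θ) = #S ^ 2 * #Θ ^ 2 := by ring
      _ ≤ #(S + Θ) * S.addEnergy Θ := h
      _ ≤ (N * #Θ) * (#S * #{x ∈ Θ ×ˢ Θ | x.1 - x.2 ∈ Γ}) := by gcongr
      _ = _ := by ring
  exact Nat.le_of_mul_le_mul_left h2 (Nat.mul_pos hS0.card_pos hΘ0.card_pos)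

end Geometry

section Ratios

lemma succ_pow_le_two_mul_pow {n m : ℕ} (h : 8 * n ≤ m) : (m + 1) ^ n ≤ 2 * m ^ n := by
  have hm : (0 : ℝ) < (m : ℝ) + 1 := by positivity
  have h1 : (8 : ℝ) * n ≤ m := by exact_mod_cast h
  have hle : 1 / ((m : ℝ) + 1) ≤ 1 := by
    rw [div_le_one hm]
    linarith [(Nat.cast_nonneg m : (0 : ℝ) ≤ m)]
  have hb := one_add_mul_le_pow (a := -(1 / ((m : ℝ) + 1))) (by linarith) n
  have h2 : 1 / 2 ≤ 1 + (n : ℝ) * -(1 / ((m : ℝ) + 1)) := by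
    have : (n : ℝ) * (1 / ((m : ℝ) + 1)) ≤ 1 / 2 := by
      rw [mul_one_div, div_le_iff₀ hm]
      linarith [(Nat.cast_nonneg n : (0 : ℝ) ≤ n)]
    linarith
  have h3 : 1 + -(1 / ((m : ℝ) + 1)) = m / (m + 1) := by field_simp; ring
  rw [h3, div_pow] at hb
  have h4 := h2.trans hb
  rw [le_div_iff₀ (by positivity)] at h4
  have : ((m : ℝ) + 1) ^ n ≤ 2 * (m : ℝ) ^ n := by linarith
  exact_mod_cast this

/-- The lattice of pairs `(u, v)` of integer vectors with `α · u = y (α · v)`. -/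
def ratioLattice {p r : ℕ} (α : Fin r → ZMod p) (y : ZMod p) : AddSubgroup (Fin r ⊕ Fin r → ℤ) where
  carrier := {d | ∑ i, (d i : ZMod p) * (Sum.elim α fun j => -(y * α j)) i = 0}
  zero_mem' := by simp
  add_mem' {a b} ha hb := by
    simp only [Set.mem_ofPred_eq] at ha hb ⊢
    simp only [Pi.add_apply, Int.cast_add, add_mul, sum_add_distrib, ha, hb, add_zero]
  neg_mem' {a} ha := by
    simp only [Set.mem_ofPred_eq] at ha ⊢
    simp only [Pi.neg_apply, Int.cast_neg, neg_mul, sum_neg_distrib, ha, neg_zero]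

lemma mem_ratioLattice {p r : ℕ} {α : Fin r → ZMod p} {y : ZMod p} {d : Fin r ⊕ Fin r → ℤ} :
    d ∈ ratioLattice α y ↔
      ∑ j, α j * (d (Sum.inl j) : ZMod p) = y * ∑ j, α j * (d (Sum.inr j) : ZMod p) := by
  change ∑ i, (d i : ZMod p) * (Sum.elim α fun j => -(y * α j)) i = 0 ↔ _
  rw [Fintype.sum_sum_type, mul_sum, ← sub_eq_zero (a := ∑ j, α j * _), sub_eq_add_neg,
    ← sum_neg_distrib]
  refine Eq.congr_left (congrArg₂ _ ?_ ?_) <;> refine sum_congr rfl fun j _ => ?_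
  · simp [mul_comm]
  · simp only [Sum.elim_inr]; ring

variable {p : ℕ} [Fact p.Prime]

/-- A nonzero short vector lies in at most one of the lattices `ratioLattice α y`. -/
lemma eq_of_mem_ratioLattice {r Bd : ℕ} {α : Fin r → ZMod p}
    (hα : ∀ u : Fin r → ℤ, (∀ j, |u j| ≤ Bd) → ∑ j, α j * (u j : ZMod p) = 0 → u = 0)
    {d : Fin r ⊕ Fin r → ℤ} (hd : ∀ i, |d i| ≤ Bd) (hd0 : d ≠ 0) {y y' : ZMod p}
    (hy : d ∈ ratioLattice α y) (hy' : d ∈ ratioLattice α y') : y = y' := by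
  rw [mem_ratioLattice] at hy hy'
  by_cases hv : ∑ j, α j * (d (Sum.inr j) : ZMod p) = 0
  · exfalso
    apply hd0
    have h2 := hα (fun j => d (Sum.inr j)) (fun j => hd _) hv
    rw [hv, mul_zero] at hy
    have h1 := hα (fun j => d (Sum.inl j)) (fun j => hd _) hy
    ext (j | j)
    exacts [congrFun h1 j, congrFun h2 j]
  · exact mul_right_cancel₀ hv (hy.symm.trans hy')

/-- Lower bound for the number of ratios `(α · u + β) / (α · v)` with `u`, `v` in boxes. -/
lemma box_le_card_ratios {r Bd Lx La : ℕ} (hr : 0 < r) {α : Fin r → ZMod p} {β : ZMod p}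
    (hα : ∀ u : Fin r → ℤ, (∀ j, |u j| ≤ Bd) → ∑ j, α j * (u j : ZMod p) = 0 → u = 0)
    (hLx : 0 < Lx) (hLa : 0 < La) (hx : 16 * r * Lx ≤ Bd) (ha : 16 * r * La ≤ Bd)
    (hp : (2 * r) ^ r * (16 * r * Lx * (16 * r * La)) ^ r < p) (Y : Finset (ZMod p))
    (hY : ∀ u v : Fin r → ℤ, (∀ j, 1 ≤ u j ∧ u j ≤ (16 * r * Lx : ℕ)) →
      (∀ j, 1 ≤ v j ∧ v j ≤ (16 * r * La : ℕ)) →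
      (∑ j, α j * (u j : ZMod p) + β) / ∑ j, α j * (v j : ZMod p) ∈ Y) :
    (16 * r * Lx * (16 * r * La)) ^ r ≤ 2 * (16 * r + 1) ^ (2 * r) * #Y := by
  classical
  set m := 16 * r with hm
  set n := 2 * r with hn
  let L : Fin r ⊕ Fin r → ℕ := Sum.elim (fun _ => Lx) (fun _ => La)
  have hL : ∀ i, 0 < L i := by rintro (j | j) <;> assumption
  have hLB : ∀ i, m * L i ≤ Bd := by rintro (j | j) <;> assumption
  have hcardι : Fintype.card (Fin r ⊕ Fin r) = n := by simp [hn, two_mul]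
  have hprodL : ∏ i, m * L i = (m * Lx * (m * La)) ^ r := by
    rw [Fintype.prod_sum_type]
    simp [L, mul_pow]
  let W := Fintype.piFinset fun i => Icc (1 : ℤ) (m * L i : ℕ)
  let Θ := Fintype.piFinset fun i => Ico (0 : ℤ) (L i)
  have hWcard : #W = ∏ i, m * L i := by
    simp only [W, Fintype.card_piFinset, Int.card_Icc, add_sub_cancel_right, Int.toNat_natCast]
  have hΘcard : #Θ = ∏ i, L i := by
    simp only [Θ, Fintype.card_piFinset, Int.card_Ico, sub_zero, Int.toNat_natCast]
  have hW : ∀ w ∈ W, ∀ i, 1 ≤ w i ∧ w i ≤ (m * L i : ℕ) := fun w hw i =>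
    mem_Icc.mp (Fintype.mem_piFinset.mp hw i)
  have hΘ : ∀ θ ∈ Θ, ∀ i, 0 ≤ θ i ∧ θ i < L i := fun θ hθ i =>
    mem_Ico.mp (Fintype.mem_piFinset.mp hθ i)
  let x : (Fin r ⊕ Fin r → ℤ) → ZMod p := fun w => ∑ j, α j * (w (Sum.inl j) : ZMod p) + β
  let a : (Fin r ⊕ Fin r → ℤ) → ZMod p := fun w => ∑ j, α j * (w (Sum.inr j) : ZMod p)
  have ha0 : ∀ w ∈ W, a w ≠ 0 := by
    intro w hw h0
    have h1 := hα (fun j => w (Sum.inr j)) (fun j => ?_) h0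
    · have h2 := congrFun h1 ⟨0, hr⟩
      have h3 := (hW w hw (Sum.inr ⟨0, hr⟩)).1
      simp only [Pi.zero_apply] at h2
      omega
    · have h3 := hW w hw (Sum.inr j)
      have h4 := hLB (Sum.inr j)
      rw [abs_le]
      constructor <;> omega
  have hmaps : ∀ w ∈ W, x w / a w ∈ Y := fun w hw =>
    hY _ _ (fun j => hW w hw (Sum.inl j)) fun j => hW w hw (Sum.inr j)
  set N := n * (m + 1) ^ (n - 1) with hN
  let off : ZMod p → Finset ((Fin r ⊕ Fin r → ℤ) × (Fin r ⊕ Fin r → ℤ)) := fun y =>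
    {z ∈ Θ ×ˢ Θ | z.1 ≠ z.2 ∧ z.1 - z.2 ∈ ratioLattice α y}
  have hαne : α ≠ 0 := by
    rintro rfl
    have h1 := hα (fun _ => 1) (fun j => ?_) (by simp)
    · have := congrFun h1 ⟨0, hr⟩
      simp at this
    · have : 0 < m * Lx := Nat.mul_pos (by omega) hLx
      simp only [abs_one]
      omega
  have hfiber : ∀ y ∈ Y, #{w ∈ W | x w / a w = y} * #Θ ≤ N * (#Θ + #(off y)) := by
    intro y _
    set S := {w ∈ W | x w / a w = y} with hS
    have hdiff : ∀ w ∈ S, ∀ w' ∈ S, w - w' ∈ ratioLattice α y := by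
      intro w hw w' hw'
      rw [hS, mem_filter] at hw hw'
      have e1 := (div_eq_iff (ha0 w hw.1)).mp hw.2
      have e2 := (div_eq_iff (ha0 w' hw'.1)).mp hw'.2
      rw [mem_ratioLattice]
      simp only [Pi.sub_apply, Int.cast_sub, mul_sub, sum_sub_distrib]
      simp only [x, a] at e1 e2
      linear_combination e1 - e2
    have hγ : (Sum.elim α fun j => -(y * α j)) ≠ 0 := fun h =>
      hαne (funext fun j => congrFun h (Sum.inl j))
    have hdet : √(Fintype.card (Fin r ⊕ Fin r)) ^ Fintype.card (Fin r ⊕ Fin r) *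
        ∏ i, ((m * L i : ℕ) : ℝ) < p := by
      rw [hcardι, hn, pow_mul, Real.sq_sqrt (by positivity), ← Nat.cast_prod, hprodL]
      exact_mod_cast hp
    obtain ⟨c, hc, hcD⟩ := exists_hyperplane_of_sum_eq_zero hγ
      {d | ∃ w ∈ S, ∃ w' ∈ S, d = w - w'} (fun i => m * L i) hdet
      (by
        rintro _ ⟨w, hw, w', hw', rfl⟩ i
        have h1 := hW w (mem_filter.mp hw).1 i
        have h2 := hW w' (mem_filter.mp hw').1 i
        rw [Pi.sub_apply, abs_le]
        constructor <;> omega)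
      (by
        rintro _ ⟨w, hw, w', hw', rfl⟩
        exact hdiff w hw w' hw')
    have hsum := card_add_box_le m L hL S
      (fun w hw i => by simpa using hW w (mem_filter.mp hw).1 i) hc
      (fun w hw w' hw' => hcD _ ⟨w, hw, w', hw', rfl⟩)
    rw [hcardι, ← hΘcard] at hsum
    refine (card_mul_card_le_of_sub_mem (ratioLattice α y) S Θ hdiff hsum).trans ?_
    gcongr
    rw [← filter_union_filter_not_eq (fun z => z.1 = z.2)
      {z ∈ Θ ×ˢ Θ | z.1 - z.2 ∈ ratioLattice α y}]
    refine (card_union_le _ _).trans (add_le_add ?_ ?_)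
    · refine card_le_card_of_injOn Prod.fst ?_ ?_
      · intro z hz
        simp only [coe_filter, mem_filter, mem_product, Set.mem_ofPred_eq] at hz
        exact hz.1.1.1
      · intro z hz z' hz' h
        simp only [coe_filter, mem_filter, Set.mem_ofPred_eq] at hz hz'
        exact Prod.ext h (hz.2.symm.trans (h.trans hz'.2))
    · refine card_le_card fun z hz => ?_
      simp only [mem_filter, off] at hz ⊢
      exact ⟨hz.1.1, hz.2, hz.1.2⟩
  have hoff : ∑ y ∈ Y, #(off y) ≤ #Θ * #Θ := by
    simp only [off, card_filter]
    rw [sum_comm, ← card_product, card_eq_sum_ones]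
    refine sum_le_sum fun z hz => ?_
    rw [← card_filter, card_le_one]
    intro y hy y' hy'
    rw [mem_filter] at hy hy'
    rw [mem_product] at hz
    refine eq_of_mem_ratioLattice hα (fun i => ?_) (sub_ne_zero.mpr hy.2.1) hy.2.2 hy'.2.2
    have h1 := hΘ _ hz.1 i
    have h2 := hΘ _ hz.2 i
    have h3 := hLB i
    have h4 : L i ≤ m * L i := Nat.le_mul_of_pos_left _ (by omega)
    rw [Pi.sub_apply, abs_le]
    constructor <;> omega
  have hΘpos : 0 < #Θ := by rw [hΘcard]; exact prod_pos fun i _ => hL i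
  have hmain : #W ≤ N * #Y + N * #Θ := by
    refine Nat.le_of_mul_le_mul_right ?_ hΘpos
    calc #W * #Θ = ∑ y ∈ Y, #{w ∈ W | x w / a w = y} * #Θ := by
          rw [card_eq_sum_card_fiberwise hmaps, sum_mul]
      _ ≤ ∑ y ∈ Y, N * (#Θ + #(off y)) := sum_le_sum hfiber
      _ = N * (#Y * #Θ + ∑ y ∈ Y, #(off y)) := by
          rw [← mul_sum, sum_add_distrib, sum_const, smul_eq_mul]
      _ ≤ N * (#Y * #Θ + #Θ * #Θ) := by gcongr
      _ = _ := by ring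
  have hWΘ : #W = m ^ n * #Θ := by
    rw [hWcard, hΘcard, prod_mul_distrib, prod_const, card_univ, hcardι]
  have hpow : (m + 1) ^ n = (m + 1) * (m + 1) ^ (n - 1) := by
    rw [← pow_succ', Nat.sub_add_cancel (by omega)]
  have h2N : 2 * N ≤ m ^ n := by
    have h1 := succ_pow_le_two_mul_pow (n := n) (m := m) (by omega)
    refine Nat.le_of_mul_le_mul_left (c := m + 1) ?_ (by omega)
    calc (m + 1) * (2 * N) = 2 * n * (m + 1) ^ n := by rw [hpow, hN]; ring
      _ ≤ 2 * n * (2 * m ^ n) := by gcongr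
      _ = (4 * n) * m ^ n := by ring
      _ ≤ (m + 1) * m ^ n := by gcongr; omega
  have hNle : N ≤ (m + 1) ^ n := by
    rw [hpow, hN]
    gcongr
    omega
  have h3 : 2 * N * #Θ ≤ #W := by rw [hWΘ]; gcongr
  rw [← hprodL, ← hWcard]
  calc #W ≤ 2 * N * #Y := by nlinarith
    _ ≤ _ := by gcongr

end Ratios

section Main

variable {p : ℕ} [Fact p.Prime]

lemma quadraticChar_eq_one_of_mem_quadRes {x : ZMod p} (hx : x ∈ quadRes p) :
    quadraticChar (ZMod p) x = 1 := by
  obtain ⟨y, hy, rfl⟩ := (mem_filter.mp hx).2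
  exact quadraticChar_sq_one' hy

/-- Few `y` have `χ` constant on `y + 1, …, y + T`. -/
lemma card_quadraticChar_run_le {T : ℕ} (hT0 : 0 < T) (hpT : p ≤ 2 ^ T)
    (hT : 4 * T + 6 ≤ Nat.sqrt p) {ε : ℤ} (hε : ε = 1 ∨ ε = -1) :
    (#{y : ZMod p | ∀ t ∈ (Icc 1 T : Finset ℕ), quadraticChar (ZMod p) (y + t) = ε} : ℝ) ≤
      24 * T * √p := by
  have hTp : T < p := by
    have := Nat.sqrt_le_self p
    omega
  have hinj : Set.InjOn (fun t : ℕ => -(t : ZMod p)) (Icc 1 T : Finset ℕ) := by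
    intro s hs t ht h
    have hs := mem_Icc.mp (mem_coe.mp hs)
    have ht := mem_Icc.mp (mem_coe.mp ht)
    have h1 := neg_injective h
    rw [ZMod.natCast_eq_natCast_iff] at h1
    exact Nat.ModEq.eq_of_lt_of_lt h1 (by omega) (by omega)
  have hcard : #((Icc 1 T).image fun t : ℕ => -(t : ZMod p)) = T := by
    rw [card_image_of_injOn hinj]
    simp
  have h0 : (0 : ZMod p) ∉ (Icc 1 T).image fun t : ℕ => -(t : ZMod p) := by
    intro h
    obtain ⟨t, ht, h⟩ := mem_image.mp h
    rw [neg_eq_zero, ZMod.natCast_eq_zero_iff] at h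
    have ht := mem_Icc.mp ht
    exact Nat.not_dvd_of_pos_of_lt (by omega) (by omega) h
  have h := two_pow_mul_card_quadraticChar_le h0 (by rwa [hcard]) hε
  rw [hcard] at h
  simp only [forall_mem_image, sub_neg_eq_add] at h
  have hs1 : (1 : ℝ) ≤ √p := by
    rw [Real.one_le_sqrt]
    exact_mod_cast (Fact.out : p.Prime).one_lt.le
  have hT1 : (1 : ℝ) ≤ T := by exact_mod_cast hT0
  have hTs : (1 : ℝ) ≤ T * √p := one_le_mul_of_one_le_of_one_le hT1 hs1
  have hp2 : (p : ℝ) ≤ 2 ^ T := by exact_mod_cast hpT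
  refine le_of_mul_le_mul_left (h.trans ?_) (by positivity : (0 : ℝ) < 2 ^ T)
  have : (2 : ℝ) ^ T * 1 ≤ 2 ^ T * (T * √p) := by gcongr
  linarith

/-- The box bound: a large proper progression of quadratic residues yields many `y` with `χ`
constant on `y + 1, …, y + T`. -/
lemma side_pow_le {r h T : ℕ} (hr : 0 < r) {α : Fin r → ZMod p} {β : ZMod p}
    (hα : ∀ u : Fin r → ℤ, (∀ j, |u j| ≤ (2 * h ^ 2 : ℕ)) → ∑ j, α j * (u j : ZMod p) = 0 → u = 0)
    (hG : ∀ u : Fin r → ℤ, (∀ j, 1 ≤ u j ∧ u j ≤ h) →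
      ∑ j, α j * (u j : ZMod p) + β ∈ quadRes p)
    (hp : (2 * h ^ 2 + 1) ^ r ≤ p) (hpT : p ≤ 2 ^ T) (hT : 4 * T + 6 ≤ Nat.sqrt p)
    (hrT : r ≤ T) (hTh : 32 * r * T ≤ h) :
    (h : ℝ) ^ (2 * r) ≤ (16 * T) ^ r * (2 * (16 * r + 1) ^ (2 * r) * (48 * T * √p)) := by
  have hT0 : 0 < T := by omega
  have hrT0 : 0 < 32 * r * T := by positivity
  set La := h / (32 * r * T) with hLa
  have hLa0 : 0 < La := Nat.div_pos hTh hrT0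
  have hle : 32 * r * T * La ≤ h := Nat.mul_div_le h _
  have hlt : h < 32 * r * T * (La + 1) := Nat.lt_mul_div_succ h hrT0
  set H := 16 * r * La with hH
  have hTH : 2 * T * H ≤ h := by rw [hH]; linarith
  have hHh : h ≤ 4 * T * H := by
    have : 32 * r * T * (La + 1) ≤ 32 * r * T * (2 * La) := by gcongr; omega
    rw [hH]
    linarith
  have hTH' : 16 * r * (T * La) = T * H := by rw [hH]; ring
  have hh2 : h ≤ 2 * h ^ 2 := by nlinarith
  have hH1 : H ≤ T * H := Nat.le_mul_of_pos_left _ hT0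
  let Z : ℤ → Finset (ZMod p) := fun ε =>
    {y : ZMod p | ∀ t ∈ (Icc 1 T : Finset ℕ), quadraticChar (ZMod p) (y + t) = ε}
  have hYcard : (#(Z 1 ∪ Z (-1)) : ℝ) ≤ 48 * T * √p := by
    have h1 := card_quadraticChar_run_le hT0 hpT hT (Or.inl rfl)
    have h2 := card_quadraticChar_run_le hT0 hpT hT (Or.inr rfl)
    have h3 : (#(Z 1 ∪ Z (-1)) : ℝ) ≤ #(Z 1) + #(Z (-1)) := by
      exact_mod_cast card_union_le _ _
    linarith
  have hkey : (T * H * H) ^ r ≤ 2 * (16 * r + 1) ^ (2 * r) * #(Z 1 ∪ Z (-1)) := by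
    have := box_le_card_ratios (Bd := 2 * h ^ 2) (Lx := T * La) (La := La) (β := β) hr hα
      (Nat.mul_pos hT0 hLa0) hLa0 (by rw [hTH']; linarith) (by rw [← hH]; linarith) ?_
      (Z 1 ∪ Z (-1)) ?_
    · rwa [hTH', ← hH] at this
    · rw [hTH', ← hH, ← mul_pow]
      refine lt_of_lt_of_le (Nat.pow_lt_pow_left (b := 2 * h ^ 2 + 1) ?_ hr.ne') hp
      have : (2 * T * H) * (2 * T * H) ≤ h * h := by gcongr
      have : r * (T * H * H) ≤ T * (T * H * H) := by gcongr
      nlinarith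
    · intro u v hu hv
      rw [hTH'] at hu
      rw [← hH] at hv
      set a := ∑ j, α j * (v j : ZMod p) with ha
      have ha0 : a ≠ 0 := by
        intro h0
        have h1 := hα v (fun j => ?_) h0
        · have h2 := hv ⟨0, hr⟩
          rw [h1, Pi.zero_apply] at h2
          omega
        · have h2 := hv j
          have h3 : H ≤ 2 * h ^ 2 := by linarith
          rw [abs_le]
          constructor <;> omega
      have hrun : ∀ t ∈ Icc 1 T, quadraticChar (ZMod p)
          ((∑ j, α j * (u j : ZMod p) + β) / a + (t : ℕ)) = quadraticChar (ZMod p) a := by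
        intro t ht
        have ht := mem_Icc.mp ht
        have h1 := quadraticChar_eq_one_of_mem_quadRes (hG (fun j => u j + t * v j) fun j => ?_)
        · have e : ∑ j, α j * ((u j + t * v j : ℤ) : ZMod p) + β =
              ((∑ j, α j * (u j : ZMod p) + β) / a + (t : ℕ)) * a := by
            rw [add_mul, div_mul_cancel₀ _ ha0, ha, mul_sum]
            push_cast
            simp only [mul_add, sum_add_distrib]
            rw [add_right_comm]
            congr 2
            funext j
            ring
          rw [e, map_mul] at h1
          rcases quadraticChar_dichotomy ha0 with h | h <;> rw [h] at h1 ⊢ <;> linarith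
        · have h2 := hu j
          have h3 := hv j
          have h4 : (t : ℤ) * v j ≤ T * H := by
            have : (t : ℤ) ≤ T := by exact_mod_cast ht.2
            exact mul_le_mul this h3.2 (by omega) (by positivity)
          have h5 : 0 ≤ (t : ℤ) * v j := mul_nonneg (by positivity) (by omega)
          have h6 : 2 * ((T : ℤ) * H) ≤ h := by
            rw [← mul_assoc]
            exact_mod_cast hTH
          push_cast at h2
          constructor <;> linarith
      rw [mem_union]
      rcases quadraticChar_dichotomy ha0 with h | h <;> rw [h] at hrun
      · exact Or.inl (mem_filter.mpr ⟨mem_univ _, hrun⟩)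
      · exact Or.inr (mem_filter.mpr ⟨mem_univ _, hrun⟩)
  have hkey' : ((T : ℝ) * H * H) ^ r ≤ 2 * (16 * r + 1) ^ (2 * r) * #(Z 1 ∪ Z (-1)) := by
    exact_mod_cast hkey
  have hHh' : (h : ℝ) ≤ 4 * T * H := by exact_mod_cast hHh
  calc (h : ℝ) ^ (2 * r) ≤ (4 * T * H) ^ (2 * r) := by gcongr
    _ = (16 * T) ^ r * (T * H * H) ^ r := by
        rw [pow_mul, ← mul_pow]
        ring
    _ ≤ (16 * T) ^ r * (2 * (16 * r + 1) ^ (2 * r) * #(Z 1 ∪ Z (-1))) := by gcongr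
    _ ≤ _ := by gcongr

end Main

/-- The numerical contradiction between the two bounds for the side length. -/
lemma not_side_pow_le {Λ T s h : ℝ} {r : ℕ} (hΛ : 96 ≤ Λ) (hr : 0 < r) (hs : 0 < s)
    (hT0 : 0 ≤ T) (hT : T ≤ Λ) (hrΛ : 84 * r ≤ Λ) (hh : s * Λ ^ (3 * r + 2) < h ^ (2 * r)) :
    ¬ h ^ (2 * r) ≤ (16 * T) ^ r * (2 * (16 * r + 1) ^ (2 * r) * (48 * T * s)) := by
  intro hle
  have hr1 : (1 : ℝ) ≤ r := by exact_mod_cast hr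
  have hΛ0 : 0 ≤ Λ := by linarith
  have h1 : (16 * T) * (16 * (r : ℝ) + 1) ^ 2 ≤ Λ ^ 3 := by
    have e1 : 16 * (r : ℝ) + 1 ≤ 17 / 84 * Λ := by linarith
    have e2 : (16 * T) * (16 * (r : ℝ) + 1) ^ 2 ≤ (16 * Λ) * (17 / 84 * Λ) ^ 2 := by gcongr
    have e3 : (16 * Λ) * (17 / 84 * Λ) ^ 2 = 16 * (17 / 84) ^ 2 * Λ ^ 3 := by ring
    have e4 : 0 ≤ Λ ^ 3 := by positivity
    have e5 : (16 : ℝ) * (17 / 84) ^ 2 ≤ 1 := by norm_num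
    rw [e3] at e2
    exact e2.trans (mul_le_of_le_one_left e4 e5)
  have h2 : (16 * T) ^ r * (2 * (16 * (r : ℝ) + 1) ^ (2 * r) * (48 * T * s)) ≤
      s * Λ ^ (3 * r + 2) := by
    calc (16 * T) ^ r * (2 * (16 * (r : ℝ) + 1) ^ (2 * r) * (48 * T * s))
        = ((16 * T) * (16 * (r : ℝ) + 1) ^ 2) ^ r * (96 * T * s) := by
          rw [mul_pow (16 * T), ← pow_mul]; ring
      _ ≤ (Λ ^ 3) ^ r * (Λ * Λ * s) := by gcongr
      _ = _ := by rw [← pow_mul]; ring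
  linarith

theorem stmt8 :
    ∃ c : ℝ, 0 < c ∧
      ∀ (p : ℕ) [Fact p.Prime] (r h : ℕ), 0 < r → 0 < h →
        ∀ (α : Fin r → ZMod p) (β : ZMod p),
          -- the enlarged GAP `{α₁x₁ + … + α_r x_r + β : x_j ∈ ℤ, |x_j| ≤ h²}` is proper
          ((Fintype.piFinset fun _ : Fin r => Finset.Icc (-(h ^ 2 : ℤ)) (h ^ 2)).image
              (fun x : Fin r → ℤ => (∑ j, α j * ((x j : ZMod p))) + β)).card
            = (2 * h ^ 2 + 1) ^ r →
          ∀ G : Finset (ZMod p),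
            G = (Fintype.piFinset fun _ : Fin r => Finset.Icc 1 h).image
                  (fun x : Fin r → ℕ => (∑ j, α j * ((x j : ZMod p))) + β) →
            G ⊆ quadRes p →
            (G.card : ℝ) ≤
              c * (p : ℝ) ^ ((1 : ℝ) / 4) *
                (2 * Real.logb 2 p) ^ (3 * (r : ℝ) / 2 + 1) := by
  refine ⟨2 ^ 64, by positivity, ?_⟩
  intro p _ r h hr hh α β hproper G hGdef hG
  have hp2 : 2 ≤ p := (Fact.out : p.Prime).two_le
  have hp2r : (2 : ℝ) ≤ p := by exact_mod_cast hp2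
  have hp0 : (0 : ℝ) < p := by linarith
  set L := Real.logb 2 p with hL
  have hL1 : 1 ≤ L := by
    rw [hL, Real.le_logb_iff_rpow_le (by norm_num) hp0]
    simpa using hp2r
  set Λ := 2 * L with hΛdef
  have hΛ1 : 1 ≤ Λ := by linarith
  clear_value Λ
  set E := (p : ℝ) ^ ((1 : ℝ) / 4) * Λ ^ (3 * (r : ℝ) / 2 + 1) with hE
  have hE1 : 1 ≤ E := one_le_mul_of_one_le_of_one_le
    (Real.one_le_rpow (by linarith) (by norm_num)) (Real.one_le_rpow hΛ1 (by positivity))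
  rw [mul_assoc, ← hE]
  by_cases hsmall : p < 2 ^ 64
  · have h1 : #G ≤ p := by
      have := card_le_univ G
      rwa [ZMod.card] at this
    have h2 : (#G : ℝ) ≤ 2 ^ 64 := by exact_mod_cast (h1.trans hsmall.le)
    exact h2.trans (le_mul_of_one_le_right (by positivity) hE1)
  rw [not_lt] at hsmall
  by_contra hbig
  rw [not_le] at hbig
  have hEG : E < #G := lt_of_le_of_lt (le_mul_of_one_le_left (by linarith) (by norm_num)) hbig
  have hGcard : #G ≤ h ^ r := by
    rw [hGdef]
    refine card_image_le.trans ?_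
    simp [Fintype.card_piFinset]
  have hEh : E < (h : ℝ) ^ r := lt_of_lt_of_le hEG (by exact_mod_cast hGcard)
  have hE2 : E ^ 2 = √p * Λ ^ (3 * r + 2) := by
    rw [hE, mul_pow, ← Real.rpow_mul_natCast hp0.le, ← Real.rpow_mul_natCast (by linarith),
      Real.sqrt_eq_rpow, ← Real.rpow_natCast Λ]
    congr 2 <;> push_cast <;> ring
  have hlow : √p * Λ ^ (3 * r + 2) < (h : ℝ) ^ (2 * r) := by
    rw [← hE2, mul_comm 2 r, pow_mul]
    exact pow_lt_pow_left₀ hEh (by linarith) two_ne_zero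
  have hcardle : (2 * h ^ 2 + 1) ^ r ≤ p := by
    rw [← hproper]
    refine (card_le_univ _).trans ?_
    rw [ZMod.card]
  have hinj : Set.InjOn (fun x : Fin r → ℤ => (∑ j, α j * ((x j : ZMod p))) + β)
      (Fintype.piFinset fun _ : Fin r => Finset.Icc (-(h ^ 2 : ℤ)) (h ^ 2) : Finset _) := by
    rw [← card_image_iff, hproper, Fintype.card_piFinset]
    simp only [Int.card_Icc, prod_const, card_univ, Fintype.card_fin]
    congr 1
    have : (h : ℤ) ^ 2 = ((h ^ 2 : ℕ) : ℤ) := by push_cast; rfl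
    omega
  have hα : ∀ u : Fin r → ℤ, (∀ j, |u j| ≤ (2 * h ^ 2 : ℕ)) →
      ∑ j, α j * (u j : ZMod p) = 0 → u = 0 := by
    intro u hu hu0
    have hcast : (h : ℤ) ^ 2 = ((h ^ 2 : ℕ) : ℤ) := by push_cast; rfl
    have heq := hinj (x₁ := fun j => u j / 2) (x₂ := fun j => u j / 2 - u j) ?_ ?_ ?_
    · funext j
      have := congrFun heq j
      simp only [Pi.zero_apply] at this ⊢
      omega
    · rw [mem_coe, Fintype.mem_piFinset]
      intro j
      have := abs_le.mp (hu j)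
      rw [mem_Icc, hcast]
      constructor <;> omega
    · rw [mem_coe, Fintype.mem_piFinset]
      intro j
      have := abs_le.mp (hu j)
      rw [mem_Icc, hcast]
      constructor <;> omega
    · simp only [Int.cast_sub, mul_sub, sum_sub_distrib, hu0, sub_zero]
  have hGmem : ∀ u : Fin r → ℤ, (∀ j, 1 ≤ u j ∧ u j ≤ h) →
      ∑ j, α j * (u j : ZMod p) + β ∈ quadRes p := by
    intro u hu
    apply hG
    rw [hGdef, mem_image]
    refine ⟨fun j => (u j).toNat, ?_, ?_⟩
    · rw [Fintype.mem_piFinset]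
      intro j
      have := hu j
      rw [mem_Icc]
      omega
    · congr 1
      refine sum_congr rfl fun j _ => ?_
      have h1 : ((u j).toNat : ℤ) = u j := Int.toNat_of_nonneg (by linarith [(hu j).1])
      rw [← Int.cast_natCast, h1]
  have hL64 : 64 ≤ L := by
    rw [hL, Real.le_logb_iff_rpow_le (by norm_num) hp0]
    have : ((2 ^ 64 : ℕ) : ℝ) ≤ p := by exact_mod_cast hsmall
    exact_mod_cast this
  have hΛ128 : 128 ≤ Λ := by linarith
  have h2h : (2 * (h : ℝ) ^ 2) ^ r ≤ p := by
    have : (2 * h ^ 2) ^ r ≤ p := (Nat.pow_le_pow_left (Nat.le_succ _) r).trans hcardle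
    exact_mod_cast this
  have hh0 : (0 : ℝ) < h := by exact_mod_cast hh
  have hΛh : Λ ^ 6 ≤ (h : ℝ) ^ 2 := by
    have e1 : (√p * Λ ^ (3 * r + 2)) ^ 2 < ((h : ℝ) ^ (2 * r)) ^ 2 :=
      pow_lt_pow_left₀ hlow (by positivity) two_ne_zero
    have e2 : (p : ℝ) * (Λ ^ 6) ^ r ≤ (√p * Λ ^ (3 * r + 2)) ^ 2 := by
      rw [mul_pow, Real.sq_sqrt hp0.le, ← pow_mul, ← pow_mul]
      exact mul_le_mul_of_nonneg_left (pow_le_pow_right₀ hΛ1 (by omega)) hp0.le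
    have e3 : ((h : ℝ) ^ 2) ^ r * (Λ ^ 6) ^ r < ((h : ℝ) ^ 2) ^ r * ((h : ℝ) ^ 2) ^ r := by
      have e4 : ((h : ℝ) ^ 2) ^ r ≤ p := le_trans (by gcongr; nlinarith) h2h
      calc ((h : ℝ) ^ 2) ^ r * (Λ ^ 6) ^ r ≤ p * (Λ ^ 6) ^ r := by gcongr
        _ < ((h : ℝ) ^ (2 * r)) ^ 2 := e2.trans_lt e1
        _ = _ := by rw [← pow_mul]; ring
    exact (lt_of_pow_lt_pow_left₀ r (by positivity)
      (lt_of_mul_lt_mul_left e3 (by positivity))).le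
  have hΛp : (Λ ^ 6) ^ r ≤ p := le_trans (by gcongr; nlinarith) h2h
  have hrL : 42 * (r : ℝ) ≤ L := by
    rw [hL, Real.le_logb_iff_rpow_le (by norm_num) hp0]
    refine le_trans ?_ hΛp
    have : (2 : ℝ) ^ (42 * (r : ℝ)) = (128 ^ 6) ^ r := by
      rw [show (42 * (r : ℝ)) = ((42 * r : ℕ) : ℝ) by push_cast; ring, Real.rpow_natCast, pow_mul]
      norm_num
    rw [this]
    gcongr
  set T := Nat.log 2 p + 1 with hT
  have hpT : p ≤ 2 ^ T := (Nat.lt_pow_succ_log_self (by norm_num) p).le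
  have hLT : L ≤ T := by
    rw [hL, Real.logb_le_iff_le_rpow (by norm_num) hp0, Real.rpow_natCast]
    exact_mod_cast hpT
  have hTΛ : (T : ℝ) ≤ Λ := by
    have h1 : ((2 ^ Nat.log 2 p : ℕ) : ℝ) ≤ p := by
      exact_mod_cast Nat.pow_log_le_self 2 (by omega)
    have h2 : (Nat.log 2 p : ℝ) ≤ L := by
      rw [hL, Real.le_logb_iff_rpow_le (by norm_num) hp0, Real.rpow_natCast]
      exact_mod_cast h1
    rw [hT]
    push_cast
    linarith
  have hrT : r ≤ T := by
    have : (r : ℝ) ≤ T := by linarith [(Nat.cast_nonneg r : (0 : ℝ) ≤ r)]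
    exact_mod_cast this
  have hTh : 32 * r * T ≤ h := by
    have h3 : Λ ^ 3 ≤ h := by
      refine le_of_sq_le_sq ?_ hh0.le
      rw [← pow_mul]
      exact hΛh
    have : (32 * (r : ℝ)) * T ≤ h := by
      calc (32 * (r : ℝ)) * T ≤ Λ * Λ := by gcongr; linarith [(Nat.cast_nonneg r : (0 : ℝ) ≤ r)]
        _ = Λ ^ 2 := by ring
        _ ≤ Λ ^ 3 := by gcongr; norm_num
        _ ≤ h := h3
    exact_mod_cast this
  have hTsqrt : 4 * T + 6 ≤ Nat.sqrt p := by
    rw [Nat.le_sqrt]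
    have : (4 * (T : ℝ) + 6) * (4 * T + 6) ≤ p := by
      calc (4 * (T : ℝ) + 6) * (4 * T + 6) ≤ (5 * Λ) * (5 * Λ) := by gcongr <;> linarith
        _ = 25 * Λ ^ 2 := by ring
        _ ≤ Λ * Λ ^ 2 := by gcongr; linarith
        _ = Λ ^ 3 := by ring
        _ ≤ Λ ^ (6 * r) := by gcongr; omega
        _ = (Λ ^ 6) ^ r := by rw [pow_mul]
        _ ≤ p := hΛp
    exact_mod_cast this
  exact not_side_pow_le (by linarith) hr (Real.sqrt_pos.mpr hp0) (by positivity) hTΛ (by linarith)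
    hlow (side_pow_le hr hα hGmem hcardle hpT hTsqrt hrT hTh)
end

section
/- There exists an absolute constant C > 0 with the following property. Let p be a prime, A ⊆ F_p a nonempty set with |A + A| ≤ K·|A| for some real K ≥ 1, and let d ≥ 2 and l ≥ 1 be integers. Then there exist an element a_* ∈ A and a set Z ⊆ A − a_* with |Z| ≥ exp(−C·l³·d²·(log K)²)·|A| such that j·Z ⊆ 2A − 2A for every integer j ∈ {1, 2, …, d^l} (where j acts by multiplication by the image of j in F_p, and 2A − 2A = A + A − A − A). -/
open Finset Pointwise

/-- If the maps `f t` are injective on `Y` and take values in `W`, some value in `W` is attained by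
`f t` for at least `|T| |Y| / |W|` of the `t ∈ T`. -/
theorem exists_popular_value {α β γ : Type*} [DecidableEq γ] {T : Finset α}
    {Y : Finset β} {W : Finset γ} (hT : T.Nonempty) (hY : Y.Nonempty) (f : α → β → γ)
    (hinj : ∀ t, Function.Injective (f t)) (hf : ∀ t ∈ T, ∀ y ∈ Y, f t y ∈ W) :
    ∃ w, ∃ T' ⊆ T, (∀ t ∈ T', ∃ y ∈ Y, f t y = w) ∧ #T * #Y ≤ #W * #T' := by
  classical
  obtain ⟨t₀, ht₀⟩ := hT
  obtain ⟨y₀, hy₀⟩ := hY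
  have hmaps : ∀ q ∈ T ×ˢ Y, f q.1 q.2 ∈ W := fun q hq =>
    hf _ (mem_product.1 hq).1 _ (mem_product.1 hq).2
  have hsum := card_eq_sum_card_fiberwise (f := fun q : α × β => f q.1 q.2) hmaps
  obtain ⟨w, -, hw⟩ := exists_max_image W (fun w => #{q ∈ T ×ˢ Y | f q.1 q.2 = w})
    ⟨_, hf t₀ ht₀ y₀ hy₀⟩
  refine ⟨w, {t ∈ T | ∃ y ∈ Y, f t y = w}, filter_subset _ _,
    fun t ht => (mem_filter.1 ht).2, ?_⟩
  rw [← card_product, hsum]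
  refine (sum_le_card_nsmul _ _ _ hw).trans ?_
  rw [smul_eq_mul]
  refine Nat.mul_le_mul_left _ (card_le_card_of_injOn Prod.fst ?_ ?_)
  · rintro ⟨t, y⟩ h
    simp only [coe_filter, mem_product, Set.mem_ofPred_eq] at h ⊢
    exact ⟨h.1.1, y, h.1.2, h.2⟩
  · rintro ⟨t, y⟩ h ⟨t', y'⟩ h' (rfl : t = t')
    simp only [coe_filter, mem_product, Set.mem_ofPred_eq] at h h'
    rw [hinj t (h.2.trans h'.2.symm)]

/-- Sub-Gaussian bound for the exponential moment of a sum of independent samples of a bounded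
mean-zero function. -/
theorem sum_exp_sum_le {α : Type*} [DecidableEq α] (A : Finset α) (g : α → ℝ)
    (hmean : ∑ a ∈ A, g a = 0) (hg : ∀ a, |g a| ≤ 1) (k : ℕ) {θ : ℝ} (hθ : |θ| ≤ 1) :
    ∑ y ∈ Fintype.piFinset (fun _ : Fin k => A), Real.exp (θ * ∑ i, g (y i)) ≤
      (#A : ℝ) ^ k * Real.exp (k * θ ^ 2) := by
  have hfactor : ∑ a ∈ A, Real.exp (θ * g a) ≤ #A * Real.exp (θ ^ 2) := by
    have hpt : ∀ a ∈ A, Real.exp (θ * g a) ≤ 1 + θ ^ 2 + θ * g a := by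
      intro a _
      have habs : |θ * g a| ≤ 1 := by
        rw [abs_mul]; exact mul_le_one₀ hθ (abs_nonneg _) (hg a)
      have hexp := (abs_le.1 (Real.abs_exp_sub_one_sub_id_le habs)).2
      have hsq : g a ^ 2 ≤ 1 := (sq_le_one_iff_abs_le_one _).2 (hg a)
      nlinarith [sq_nonneg θ]
    refine (sum_le_sum hpt).trans ?_
    rw [sum_add_distrib, ← mul_sum, hmean, sum_const, nsmul_eq_mul, mul_zero, add_zero]
    gcongr
    linarith [Real.add_one_le_exp (θ ^ 2)]
  calc ∑ y ∈ Fintype.piFinset (fun _ : Fin k => A), Real.exp (θ * ∑ i, g (y i))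
      = ∏ _i : Fin k, ∑ a ∈ A, Real.exp (θ * g a) := by
        rw [prod_univ_sum]
        refine sum_congr rfl fun y _ => ?_
        rw [mul_sum, Real.exp_sum]
    _ = (∑ a ∈ A, Real.exp (θ * g a)) ^ k := by simp
    _ ≤ (#A * Real.exp (θ ^ 2)) ^ k := by
        gcongr
    _ = _ := by rw [mul_pow, ← Real.exp_nat_mul]

section AlmostPeriods

variable {G : Type*} [AddCommGroup G]

/-- On any set of size at most `n`, the `ℓ¹` distance between `f` and its translate by `s` is at
most `δ`. -/
def IsAlmostPeriod (f : G → ℝ) (n : ℕ) (δ : ℝ) (s : G) : Prop :=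
  ∀ B : Finset G, #B ≤ n → ∑ x ∈ B, |f (x + s) - f x| ≤ δ

theorem IsAlmostPeriod.add {f : G → ℝ} {n : ℕ} {δ δ' : ℝ} {s s' : G}
    (hs : IsAlmostPeriod f n δ s) (hs' : IsAlmostPeriod f n δ' s') :
    IsAlmostPeriod f n (δ + δ') (s + s') := by
  intro B hB
  have hshift := hs (B.map (addRightEmbedding s')) (by simpa using hB)
  rw [sum_map] at hshift
  refine le_trans ?_ (add_le_add hshift (hs' B hB))
  rw [← sum_add_distrib]
  refine sum_le_sum fun x _ => ?_
  simp only [addRightEmbedding_apply]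
  rw [show x + (s + s') = x + s' + s by abel]
  exact abs_sub_le _ _ _

theorem isAlmostPeriod_nsmul {f : G → ℝ} {n : ℕ} {δ : ℝ} (hδ : 0 ≤ δ) {z : G} (m : ℕ)
    (hz : ∀ i < m, IsAlmostPeriod f n δ ((2 ^ i) • z)) :
    ∀ j < 2 ^ m, IsAlmostPeriod f n (m * δ) (j • z) := by
  induction m with
  | zero =>
    intro j hj B _
    obtain rfl : j = 0 := by simpa using hj
    simp
  | succ m ih =>
    intro j hj
    have ih' := ih fun i hi => hz i (hi.trans m.lt_succ_self)
    rcases lt_or_ge j (2 ^ m) with hlt | hge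
    · intro B hB
      refine (ih' j hlt B hB).trans ?_
      push_cast
      linarith
    · obtain ⟨j', rfl⟩ := Nat.exists_eq_add_of_le' hge
      have hj' : j' < 2 ^ m := by rw [pow_succ] at hj; omega
      have hsum := (ih' j' hj').add (hz m m.lt_succ_self)
      rw [← add_nsmul] at hsum
      convert hsum using 1
      push_cast
      ring

variable [DecidableEq G]

/-- The proportion of `a ∈ A` with `x + a ∈ S`. -/
noncomputable def density (A S : Finset G) (x : G) : ℝ :=
  (∑ a ∈ A, if x + a ∈ S then 1 else 0) / #A

/-- The deviation of the number of `i` with `x + y i ∈ S` from `k` times the density. -/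
noncomputable def deviation (A S : Finset G) {k : ℕ} (y : Fin k → G) (x : G) : ℝ :=
  ∑ i, ((if x + y i ∈ S then 1 else 0) - density A S x)

/-- The sample `y` approximates the density, in `ℓ¹` on every set of size at most `|A|`. -/
def IsGoodSample (A S : Finset G) (η : ℝ) {k : ℕ} (y : Fin k → G) : Prop :=
  ∀ B : Finset G, #B ≤ #A → ∑ x ∈ B, |deviation A S y x| ≤ η

theorem density_nonneg (A S : Finset G) (x : G) : 0 ≤ density A S x := by
  unfold density
  refine div_nonneg (sum_nonneg fun a _ => ?_) (Nat.cast_nonneg _)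
  split_ifs <;> norm_num

theorem density_le_one (A S : Finset G) (x : G) : density A S x ≤ 1 := by
  unfold density
  refine div_le_one_of_le₀ ?_ (Nat.cast_nonneg _)
  calc (∑ a ∈ A, if x + a ∈ S then (1 : ℝ) else 0) ≤ ∑ a ∈ A, (1 : ℝ) :=
        sum_le_sum fun a _ => by split_ifs <;> norm_num
    _ = #A := by simp

theorem deviation_eq_zero {A S : Finset G} {k : ℕ} {y : Fin k → G} (hy : ∀ i, y i ∈ A) {x : G}
    (hx : x ∉ S - A) : deviation A S y x = 0 := by
  have hmem : ∀ a ∈ A, x + a ∉ S := fun a ha hS =>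
    hx (mem_sub.2 ⟨_, hS, a, ha, add_sub_cancel_right x a⟩)
  have hdens : density A S x = 0 := by
    unfold density
    rw [sum_eq_zero fun a ha => if_neg (hmem a ha), zero_div]
  unfold deviation
  exact sum_eq_zero fun i _ => by rw [hdens, if_neg (hmem _ (hy i)), sub_zero]

/-- Most samples from `A` are good. -/
theorem card_le_two_mul_card_good {A S : Finset G} (hA : A.Nonempty) (k : ℕ) {θ R η : ℝ}
    (hθ₀ : 0 < θ) (hθ₁ : θ ≤ 1) (hR : 1 ≤ R) (hcard : (#(S - A) : ℝ) ≤ R * #A)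
    (hη : (Real.log (4 * R) + k * θ ^ 2 + 1) * #A ≤ θ * η) :
    ∃ Y ⊆ Fintype.piFinset (fun _ : Fin k => A),
      (∀ y ∈ Y, IsGoodSample A S η y) ∧ (#A : ℝ) ^ k ≤ 2 * #Y := by
  classical
  have hA₀ : (0 : ℝ) < #A := by exact_mod_cast hA.card_pos
  set Ω := Fintype.piFinset (fun _ : Fin k => A) with hΩ
  set E := Real.exp (k * θ ^ 2) with hE
  have hE₀ : 0 < E := Real.exp_pos _
  set V : (Fin k → G) → ℝ := fun y => ∑ x ∈ S - A, Real.exp (θ * |deviation A S y x|) with hV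
  have hV₀ : ∀ y, 0 ≤ V y := fun y => sum_nonneg fun x _ => (Real.exp_pos _).le
  have hΩcard : (#Ω : ℝ) = (#A : ℝ) ^ k := by simp [hΩ]
  have hpoint : ∀ x, ∑ y ∈ Ω, Real.exp (θ * |deviation A S y x|) ≤ 2 * ((#A : ℝ) ^ k * E) := by
    intro x
    set g : G → ℝ := fun a => (if x + a ∈ S then 1 else 0) - density A S x with hg
    have hmean : ∑ a ∈ A, g a = 0 := by
      rw [hg, sum_sub_distrib, sum_const, nsmul_eq_mul, density, mul_div_cancel₀ _ hA₀.ne',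
        sub_self]
    have hbound : ∀ a, |g a| ≤ 1 := by
      intro a
      have h₀ := density_nonneg A S x
      have h₁ := density_le_one A S x
      rw [abs_le]
      simp only [hg]
      split_ifs <;> constructor <;> linarith
    have hpos := sum_exp_sum_le A g hmean hbound k (θ := θ) (by rw [abs_of_pos hθ₀]; exact hθ₁)
    have hneg := sum_exp_sum_le A g hmean hbound k (θ := -θ)
      (by rw [abs_neg, abs_of_pos hθ₀]; exact hθ₁)
    rw [neg_sq] at hneg
    calc ∑ y ∈ Ω, Real.exp (θ * |deviation A S y x|)
        ≤ ∑ y ∈ Ω, (Real.exp (θ * ∑ i, g (y i)) + Real.exp (-θ * ∑ i, g (y i))) := by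
          refine sum_le_sum fun y _ => ?_
          change Real.exp (θ * |∑ i, g (y i)|) ≤ _
          rcases abs_cases (∑ i, g (y i)) with h | h <;> rw [h.1]
          · linarith [Real.exp_pos (-θ * ∑ i, g (y i))]
          · rw [mul_neg, ← neg_mul]
            linarith [Real.exp_pos (θ * ∑ i, g (y i))]
      _ ≤ _ := by rw [sum_add_distrib]; linarith
  have htotal : ∑ y ∈ Ω, V y ≤ #(S - A) * (2 * ((#A : ℝ) ^ k * E)) := by
    rw [hV, sum_comm]
    calc _ ≤ ∑ x ∈ S - A, 2 * ((#A : ℝ) ^ k * E) := sum_le_sum fun x _ => hpoint x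
      _ = _ := by rw [sum_const, nsmul_eq_mul]
  refine ⟨{y ∈ Ω | V y ≤ 4 * R * #A * E}, filter_subset _ _, ?_, ?_⟩
  · intro y hy B hB
    obtain ⟨hyΩ, hVy⟩ := mem_filter.1 hy
    have hyA : ∀ i, y i ∈ A := Fintype.mem_piFinset.1 hyΩ
    set M := Real.log (4 * R) + k * θ ^ 2 with hM
    have hM₀ : 0 ≤ M := add_nonneg (Real.log_nonneg (by linarith)) (by positivity)
    have hexpM : Real.exp M = 4 * R * E := by
      rw [hM, Real.exp_add, Real.exp_log (by linarith)]
    have hsmall : ∑ x ∈ B ∩ (S - A), |deviation A S y x| = ∑ x ∈ B, |deviation A S y x| := by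
      refine sum_subset inter_subset_left fun x hxB hx => ?_
      rw [deviation_eq_zero hyA fun h => hx (mem_inter.2 ⟨hxB, h⟩), abs_zero]
    rw [← hsmall]
    refine le_of_mul_le_mul_left (le_trans ?_ hη) hθ₀
    have hterm : ∀ u : ℝ, u ≤ M + Real.exp u / Real.exp M := by
      intro u
      rw [← Real.exp_sub]
      linarith [Real.add_one_le_exp (u - M)]
    calc θ * ∑ x ∈ B ∩ (S - A), |deviation A S y x|
        ≤ ∑ x ∈ B ∩ (S - A), (M + Real.exp (θ * |deviation A S y x|) / Real.exp M) := by
          rw [mul_sum]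
          exact sum_le_sum fun x _ => hterm _
      _ = #(B ∩ (S - A)) * M
            + (∑ x ∈ B ∩ (S - A), Real.exp (θ * |deviation A S y x|)) / Real.exp M := by
          rw [sum_add_distrib, sum_const, nsmul_eq_mul, sum_div]
      _ ≤ #A * M + V y / Real.exp M := by
          have hBA : (#(B ∩ (S - A)) : ℝ) ≤ #A := by
            exact_mod_cast (card_le_card inter_subset_left).trans hB
          refine add_le_add (mul_le_mul_of_nonneg_right hBA hM₀)
            (div_le_div_of_nonneg_right ?_ (Real.exp_pos _).le)
          exact sum_le_sum_of_subset_of_nonneg inter_subset_right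
            fun x _ _ => (Real.exp_pos _).le
      _ ≤ #A * M + #A := by
          gcongr
          rw [div_le_iff₀ (Real.exp_pos _), hexpM]
          linarith
      _ = _ := by ring
  · have hsplit := card_filter_add_card_filter_not (s := Ω) (fun y => V y ≤ 4 * R * #A * E)
    have hsplit' : (#{y ∈ Ω | V y ≤ 4 * R * #A * E} : ℝ) + #{y ∈ Ω | ¬ V y ≤ 4 * R * #A * E} =
        (#A : ℝ) ^ k := by
      rw [← hΩcard]; exact_mod_cast hsplit
    have hbad : (#{y ∈ Ω | ¬ V y ≤ 4 * R * #A * E} : ℝ) * (4 * R * #A * E) ≤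
        R * #A * (2 * ((#A : ℝ) ^ k * E)) := by
      calc _ ≤ ∑ y ∈ Ω with ¬ V y ≤ 4 * R * #A * E, V y := by
            rw [← nsmul_eq_mul]
            exact card_nsmul_le_sum _ _ _ fun y hy => (not_le.1 (mem_filter.1 hy).2).le
        _ ≤ ∑ y ∈ Ω, V y :=
            sum_le_sum_of_subset_of_nonneg (filter_subset _ _) fun y _ _ => hV₀ y
        _ ≤ _ := htotal
        _ ≤ _ := by gcongr
    have hpos : 0 < 2 * R * #A * E := by positivity
    have : (#{y ∈ Ω | ¬ V y ≤ 4 * R * #A * E} : ℝ) * 2 ≤ (#A : ℝ) ^ k := by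
      refine le_of_mul_le_mul_right ?_ hpos
      linarith
    linarith

/-- Two good samples which are translates of one another differ by an almost period. -/
theorem IsGoodSample.isAlmostPeriod {A S : Finset G} {η : ℝ} {k : ℕ} (hk : 0 < k)
    {y y' : Fin k → G} (hy : IsGoodSample A S η y) (hy' : IsGoodSample A S η y') {s : G}
    (hs : ∀ i, y' i = s + y i) :
    IsAlmostPeriod (density A S) #A (2 * η / k) s := by
  intro B hB
  have hk₀ : (0 : ℝ) < k := by exact_mod_cast hk
  have hshift := hy (B.map (addRightEmbedding s)) (by simpa using hB)
  rw [sum_map] at hshift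
  rw [le_div_iff₀ hk₀, two_mul, sum_mul]
  refine le_trans ?_ (add_le_add hshift (hy' B hB))
  rw [← sum_add_distrib]
  refine sum_le_sum fun x _ => ?_
  have hdiff : (density A S (x + s) - density A S x) * k =
      deviation A S y' x - deviation A S y (x + s) := by
    simp only [deviation, sum_sub_distrib, sum_const, card_univ, Fintype.card_fin, nsmul_eq_mul,
      hs, ← add_assoc]
    ring
  calc |density A S (x + s) - density A S x| * k
      = |deviation A S y' x - deviation A S y (x + s)| := by
        rw [← hdiff, abs_mul, abs_of_pos hk₀]
    _ ≤ |deviation A S y (x + s)| + |deviation A S y' x| := by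
        rw [add_comm |_|, ← abs_neg (deviation A S y (x + s)), sub_eq_add_neg]
        exact abs_add_le _ _

theorem card_add_sub_le {A : Finset G} (hA : A.Nonempty) {K : ℝ}
    (hK : (#(A + A) : ℝ) ≤ K * #A) : (#(A + A - A) : ℝ) ≤ K ^ 3 * #A := by
  have hA₀ : (0 : ℝ) < #A := by exact_mod_cast hA.card_pos
  have hruzsa := pluennecke_ruzsa_inequality_nsmul_sub_nsmul_add hA A 2 1
  rw [two_nsmul, one_nsmul] at hruzsa
  have hreal : (#(A + A - A) : ℝ) ≤ ((#(A + A) : ℝ) / #A) ^ 3 * #A := by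
    have hcast := (NNRat.cast_le (K := ℝ)).2 hruzsa
    push_cast at hcast
    exact hcast
  refine hreal.trans ?_
  gcongr
  exact (div_le_iff₀ hA₀).2 hK

/-- A large subset of `A` whose differences, multiplied by any of `2 ^ i` with `i < m`, are
almost periods. -/
theorem exists_large_subset_isAlmostPeriod {A : Finset G} (hA : A.Nonempty) {K : ℝ} (hK₁ : 1 ≤ K)
    (hK : (#(A + A) : ℝ) ≤ K * #A) {k : ℕ} (hk : 0 < k) {η : ℝ} {Y : Finset (Fin k → G)}
    (hYA : Y ⊆ Fintype.piFinset (fun _ : Fin k => A))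
    (hgood : ∀ y ∈ Y, IsGoodSample A (A + A) η y) (hY : (#A : ℝ) ^ k ≤ 2 * #Y) (m : ℕ) :
    ∃ T ⊆ A, T.Nonempty ∧ (#A : ℝ) ≤ (2 * K ^ (k + 3)) ^ m * #T ∧
      (∃ w, ∀ t ∈ T, ∃ a ∈ A, (2 ^ m) • t = w + a) ∧
      ∀ i < m, ∀ t ∈ T, ∀ t' ∈ T,
        IsAlmostPeriod (density A (A + A)) #A (2 * η / k) ((2 ^ i) • (t - t')) := by
  have hA₀ : (0 : ℝ) < #A := by exact_mod_cast hA.card_pos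
  have hK₀ : 0 < K := by linarith
  have hYne : Y.Nonempty := by
    rw [← card_pos]
    have : (0 : ℝ) < #Y := by linarith [pow_pos hA₀ k]
    exact_mod_cast this
  induction m with
  | zero => exact ⟨A, Subset.rfl, hA, by simp, ⟨0, fun t ht => ⟨t, ht, by simp⟩⟩, by simp⟩
  | succ m ih =>
    obtain ⟨T, hTA, hTne, hTcard, ⟨w, hw⟩, hper⟩ := ih
    obtain ⟨v, T₁, hT₁T, hv, hcard₁⟩ := exists_popular_value (γ := Fin k → G) hTne hYne
      (W := Fintype.piFinset fun _ : Fin k => A + A)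
      (fun t y i => ((2 ^ m) • t - w) + y i)
      (fun t y y' h => funext fun i => add_left_cancel (congrFun h i))
      (by
        intro t ht y hy
        obtain ⟨a, ha, hta⟩ := hw t ht
        refine Fintype.mem_piFinset.2 fun i => ?_
        rw [hta, add_sub_cancel_left]
        exact add_mem_add ha (Fintype.mem_piFinset.1 (hYA hy) i))
    have hcard₁' : (#T : ℝ) ≤ 2 * K ^ k * #T₁ := by
      have hcast : (#T : ℝ) * #Y ≤ (#(A + A) : ℝ) ^ k * #T₁ := by
        have : #T * #Y ≤ #(A + A) ^ k * #T₁ := by simpa using hcard₁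
        exact_mod_cast this
      refine le_of_mul_le_mul_right ?_ (pow_pos hA₀ k)
      calc (#T : ℝ) * (#A : ℝ) ^ k ≤ #T * (2 * #Y) := by gcongr
        _ = 2 * (#T * #Y) := by ring
        _ ≤ 2 * ((#(A + A) : ℝ) ^ k * #T₁) := by gcongr
        _ ≤ 2 * ((K * #A) ^ k * #T₁) := by gcongr
        _ = _ := by rw [mul_pow]; ring
    have hT₁ne : T₁.Nonempty := by
      have hTpos : (0 : ℝ) < #T := by exact_mod_cast hTne.card_pos
      have : (0 : ℝ) < #T₁ := pos_of_mul_pos_right (hTpos.trans_le hcard₁') (by positivity)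
      rw [← card_pos]
      exact_mod_cast this
    obtain ⟨u, T₂, hT₂T, hu, hcard₂⟩ := exists_popular_value hT₁ne hA
      (W := (A + A - A).image fun x => w + w + x)
      (fun t a => (2 ^ (m + 1)) • t - a) (fun t => sub_right_injective)
      (by
        intro t ht b hb
        obtain ⟨a, ha, hta⟩ := hw t (hT₁T ht)
        refine mem_image.2 ⟨a + a - b, sub_mem_sub (add_mem_add ha ha) hb, ?_⟩
        rw [pow_succ, mul_comm, mul_nsmul', hta, two_nsmul]
        abel)
    have hcard₂' : (#T₁ : ℝ) ≤ K ^ 3 * #T₂ := by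
      rw [card_image_of_injective _ (add_right_injective _)] at hcard₂
      refine le_of_mul_le_mul_right ?_ hA₀
      calc (#T₁ : ℝ) * #A ≤ #(A + A - A) * #T₂ := by exact_mod_cast hcard₂
        _ ≤ (K ^ 3 * #A) * #T₂ := by gcongr; exact card_add_sub_le hA hK
        _ = _ := by ring
    refine ⟨T₂, hT₂T.trans (hT₁T.trans hTA), ?_, ?_, ⟨u, fun t ht => ?_⟩, ?_⟩
    · have hTpos : (0 : ℝ) < #T₁ := by exact_mod_cast hT₁ne.card_pos
      have : (0 : ℝ) < #T₂ := pos_of_mul_pos_right (hTpos.trans_le hcard₂') (by positivity)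
      rw [← card_pos]
      exact_mod_cast this
    · calc (#A : ℝ) ≤ (2 * K ^ (k + 3)) ^ m * #T := hTcard
        _ ≤ (2 * K ^ (k + 3)) ^ m * (2 * K ^ k * (K ^ 3 * #T₂)) := by
          gcongr
          exact hcard₁'.trans (by gcongr)
        _ = _ := by ring
    · obtain ⟨a, ha, hta⟩ := hu t ht
      exact ⟨a, ha, by rw [← hta, sub_add_cancel]⟩
    · intro i hi t ht t' ht'
      rcases Nat.lt_succ_iff_lt_or_eq.1 hi with hlt | rfl
      · exact hper i hlt t (hT₁T (hT₂T ht)) t' (hT₁T (hT₂T ht'))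
      · obtain ⟨y, hy, hyv⟩ := hv t (hT₂T ht)
        obtain ⟨y', hy', hyv'⟩ := hv t' (hT₂T ht')
        refine (hgood y hy).isAlmostPeriod hk (hgood y' hy') fun j => ?_
        have hj := congrFun (hyv.trans hyv'.symm) j
        rw [nsmul_sub, ← sub_eq_zero]
        rw [← sub_eq_zero] at hj
        rw [← neg_eq_zero, ← hj]
        abel

/-- An almost period of the density of `A` in `A + A` with error below `|A|` lies in `2A - 2A`. -/
theorem IsAlmostPeriod.mem {A : Finset G} (hA : A.Nonempty) {δ : ℝ} (hδ : δ < #A) {s : G}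
    (hs : IsAlmostPeriod (density A (A + A)) #A δ s) : s ∈ A + A - A - A := by
  by_contra hmem
  have hA₀ : (0 : ℝ) < #A := by exact_mod_cast hA.card_pos
  have hterm : ∀ x ∈ A, |density A (A + A) (x + s) - density A (A + A) x| = 1 := by
    intro x hx
    have hone : density A (A + A) x = 1 := by
      unfold density
      rw [sum_congr rfl fun a ha => if_pos (add_mem_add hx ha), sum_const, nsmul_one,
        div_self hA₀.ne']
    have hzero : density A (A + A) (x + s) = 0 := by
      unfold density
      rw [sum_eq_zero, zero_div]
      intro a ha
      refine if_neg fun h => hmem ?_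
      rw [show s = x + s + a - x - a by abel]
      exact sub_mem_sub (sub_mem_sub h hx) ha
    rw [hone, hzero]
    norm_num
  have hle := hs A le_rfl
  rw [sum_congr rfl hterm, sum_const, nsmul_one] at hle
  linarith

/-- A set of small doubling contains a large set with all differences having their first multiples
in `2A - 2A`. -/
theorem exists_large_subset_nsmul_sub_mem {A : Finset G} (hA : A.Nonempty) {K : ℝ}
    (hK₁ : 3 / 2 ≤ K) (hK : (#(A + A) : ℝ) ≤ K * #A) {L : ℕ} (hL : 1 ≤ L) :
    ∃ T ⊆ A, T.Nonempty ∧ Real.exp (-(600 * L ^ 3 * Real.log K ^ 2)) * #A ≤ #T ∧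
      ∀ t ∈ T, ∀ t' ∈ T, ∀ j < 2 ^ L, j • (t - t') ∈ A + A - A - A := by
  have hA₀ : (0 : ℝ) < #A := by exact_mod_cast hA.card_pos
  have hK₀ : 0 < K := by linarith
  have hL₁ : (1 : ℝ) ≤ L := by exact_mod_cast hL
  set κ := Real.log K with hκ
  have hlog2 := Real.log_two_lt_d9
  have hκ₀ : 2 / 5 ≤ κ := by
    rw [hκ, Real.le_log_iff_exp_le hK₀]
    refine le_trans ?_ hK₁
    have := (abs_le.1 (Real.exp_bound (x := 2 / 5) (n := 4) (by norm_num [abs_le]) (by norm_num))).2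
    norm_num [sum_range_succ, Nat.factorial, abs_of_pos] at this
    linarith
  set k := ⌈576 * (L : ℝ) ^ 2 * κ⌉₊ with hkdef
  have hkge : 576 * (L : ℝ) ^ 2 * κ ≤ k := Nat.le_ceil _
  have hkle : (k : ℝ) ≤ 576 * (L : ℝ) ^ 2 * κ + 1 := (Nat.ceil_lt_add_one (by positivity)).le
  have hk : 0 < k := Nat.ceil_pos.2 (by positivity)
  have hk₀ : (0 : ℝ) < k := by exact_mod_cast hk
  have hlog4 : Real.log (4 * K ^ 3) = 2 * Real.log 2 + 3 * κ := by
    rw [Real.log_mul (by norm_num) (by positivity), Real.log_pow,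
      show (4 : ℝ) = 2 ^ 2 by norm_num, Real.log_pow]
    push_cast
    ring
  obtain ⟨Y, hYA, hgood, hY⟩ := card_le_two_mul_card_good (S := A + A) hA k (θ := 1 / (8 * L))
    (R := K ^ 3) (η := k * #A / (4 * L)) (by positivity)
    (by rw [div_le_one (by positivity)]; linarith)
    (one_le_pow₀ (by linarith)) (card_add_sub_le hA hK)
    (by
      rw [hlog4]
      have hmain : 2 * Real.log 2 + 3 * κ + 1 ≤ k / (64 * (L : ℝ) ^ 2) := by
        rw [le_div_iff₀ (by positivity)]
        nlinarith [sq_nonneg (L : ℝ)]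
      calc (2 * Real.log 2 + 3 * κ + k * (1 / (8 * (L : ℝ))) ^ 2 + 1) * #A
          ≤ (k / (64 * (L : ℝ) ^ 2) + k * (1 / (8 * (L : ℝ))) ^ 2) * #A := by
            refine mul_le_mul_of_nonneg_right ?_ hA₀.le
            linarith
        _ = _ := by field_simp; norm_num)
  obtain ⟨T, hTA, hTne, hTcard, -, hper⟩ := exists_large_subset_isAlmostPeriod hA (by linarith)
    hK hk hYA hgood hY L
  refine ⟨T, hTA, hTne, ?_, fun t ht t' ht' j hj => ?_⟩
  · rw [Real.exp_neg, inv_mul_le_iff₀ (Real.exp_pos _)]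
    refine hTcard.trans ?_
    gcongr
    rw [← Real.log_le_iff_le_exp (by positivity), Real.log_pow,
      Real.log_mul (by norm_num) (by positivity), Real.log_pow, ← hκ]
    push_cast
    have hfactor : Real.log 2 + (k + 3) * κ ≤ 600 * (L : ℝ) ^ 2 * κ ^ 2 := by
      have hL₂ : 1 ≤ (L : ℝ) ^ 2 := one_le_pow₀ hL₁
      have hκ₂ : 2 / 5 * κ ≤ κ ^ 2 := by nlinarith
      have hk₂ : k * κ ≤ (576 * (L : ℝ) ^ 2 * κ + 1) * κ := by gcongr
      have hLκ : κ ^ 2 ≤ (L : ℝ) ^ 2 * κ ^ 2 := le_mul_of_one_le_left (sq_nonneg _) hL₂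
      linarith
    calc (L : ℝ) * (Real.log 2 + (k + 3) * κ) ≤ L * (600 * (L : ℝ) ^ 2 * κ ^ 2) := by gcongr
      _ = _ := by ring
  · have hmul := isAlmostPeriod_nsmul (by positivity) L
      (fun i hi => hper i hi t ht t' ht') j hj
    refine hmul.mem hA ?_
    have : (L : ℝ) * (2 * (k * #A / (4 * L)) / k) = #A / 2 := by field_simp; norm_num
    rw [this]
    linarith

end AlmostPeriods

theorem succ_cube_le (m : ℕ) : (m + 1) ^ 3 ≤ 4 * 4 ^ m := by
  induction m with
  | zero => norm_num
  | succ m ih =>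
    rcases m.eq_zero_or_pos with rfl | hm
    · norm_num
    · rw [pow_succ 4]
      nlinarith [pow_pos hm 3, pow_pos hm 2]

theorem stmt10 :
    ∃ C : ℝ, 0 < C ∧
      ∀ (p : ℕ) [Fact p.Prime] (A : Finset (ZMod p)) (K : ℝ) (d l : ℕ),
        A.Nonempty → 1 ≤ K →
        ((A + A).card : ℝ) ≤ K * A.card →
        2 ≤ d → 1 ≤ l →
        ∃ astar ∈ A, ∃ Z : Finset (ZMod p),
          Z ⊆ A.image (fun a => a - astar) ∧
          Real.exp (-(C * (l : ℝ) ^ 3 * (d : ℝ) ^ 2 * (Real.logb 2 K) ^ 2)) * A.card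
            ≤ (Z.card : ℝ) ∧
          ∀ j ∈ Finset.Icc 1 (d ^ l),
            Z.image (fun z => (j : ZMod p) * z) ⊆ A + A - A - A := by
  refine ⟨2400, by norm_num, fun p _ A K d l hA hK₁ hK hd hl => ?_⟩
  by_cases huniv : A + A = univ
  · obtain ⟨a, ha⟩ := hA
    refine ⟨a, ha, A.image (fun x => x - a), Subset.rfl, ?_, fun j _ z _ => ?_⟩
    · rw [card_image_of_injective _ sub_left_injective]
      refine mul_le_of_le_one_left (Nat.cast_nonneg _) (Real.exp_le_one_iff.2 ?_)
      rw [neg_nonpos]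
      positivity
    · have hmem : z + a + a ∈ A + A := huniv ▸ mem_univ _
      rw [show z = z + a + a - a - a by abel]
      exact sub_mem_sub (sub_mem_sub hmem ha) ha
  by_cases hone : #A = 1
  · obtain ⟨a, rfl⟩ := card_eq_one.1 hone
    refine ⟨a, mem_singleton_self a, {0}, by simp, ?_, fun j _ => by simp⟩
    simp only [card_singleton, Nat.cast_one, mul_one]
    refine Real.exp_le_one_iff.2 ?_
    rw [neg_nonpos]
    positivity
  have hcauchy := ZMod.cauchy_davenport Fact.out hA hA
  have hlt : #(A + A) < p := by
    simpa [ZMod.card] using card_lt_card (ssubset_univ_iff.2 huniv)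
  have hApos := hA.card_pos
  have hcard : 2 * #A - 1 ≤ #(A + A) := by omega
  have hK₂ : 3 / 2 ≤ K := by
    have hA₂ : (2 : ℝ) ≤ #A := by exact_mod_cast (by omega : 2 ≤ #A)
    have hcast : 2 * (#A : ℝ) ≤ #(A + A) + 1 := by
      exact_mod_cast (by omega : 2 * #A ≤ #(A + A) + 1)
    nlinarith
  set m := Nat.log 2 d with hm
  have hdl : d ^ l < 2 ^ ((m + 1) * l) := by
    rw [pow_mul]
    exact Nat.pow_lt_pow_left (Nat.lt_pow_succ_log_self one_lt_two d) (by omega)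
  obtain ⟨T, hTA, ⟨t, ht⟩, hTcard, hT⟩ := exists_large_subset_nsmul_sub_mem hA hK₂ hK
    (L := (m + 1) * l) (Nat.mul_pos m.succ_pos hl)
  refine ⟨t, hTA ht, T.image (fun x => x - t), image_subset_image hTA, ?_, fun j hj z hz => ?_⟩
  · rw [card_image_of_injective _ sub_left_injective]
    refine le_trans ?_ hTcard
    have hκ : 0 ≤ Real.log K := Real.log_nonneg hK₁
    have hlogb : Real.log K ≤ Real.logb 2 K := by
      rw [Real.logb, le_div_iff₀ (Real.log_pos one_lt_two)]
      nlinarith [Real.log_two_lt_d9]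
    have hcube : ((m : ℝ) + 1) ^ 3 ≤ 4 * (d : ℝ) ^ 2 := by
      have hpow : 4 ^ m ≤ d ^ 2 := by
        rw [show 4 = 2 ^ 2 by norm_num, ← pow_mul, mul_comm, pow_mul]
        exact Nat.pow_le_pow_left (Nat.pow_log_le_self 2 (by omega)) 2
      exact_mod_cast (succ_cube_le m).trans (Nat.mul_le_mul_left 4 hpow)
    refine mul_le_mul_of_nonneg_right (Real.exp_le_exp.2 (neg_le_neg ?_)) (Nat.cast_nonneg _)
    push_cast
    calc 600 * (((m : ℝ) + 1) * l) ^ 3 * Real.log K ^ 2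
        = 600 * ((m : ℝ) + 1) ^ 3 * l ^ 3 * Real.log K ^ 2 := by ring
      _ ≤ 600 * (4 * (d : ℝ) ^ 2) * l ^ 3 * Real.logb 2 K ^ 2 := by gcongr
      _ = _ := by ring
  · obtain ⟨y, hy, rfl⟩ := mem_image.1 hz
    obtain ⟨x, hx, rfl⟩ := mem_image.1 hy
    rw [← nsmul_eq_mul]
    exact hT x hx t ht j ((mem_Icc.1 hj).2.trans_lt hdl)
end
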